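/- Let τ be a critical Galton–Watson tree with offspring distribution p and let 𝒜 ⊂ ℤ_+ be such that p(𝒜) = Σ_{k∈𝒜} p_k > 0. Let L_𝒜(t) denote the number of nodes of a finite tree t whose out-degree belongs to 𝒜. Then, along the infinite subsequence {n ∈ ℕ : P[L_𝒜(τ) = n] > 0}, τ conditioned on {L_𝒜(τ) = n} converges locally in distribution to the immortal tree τ* as n → ∞: for every h ∈ ℕ and every tree t of height at most h, lim_{n→∞} P[r_h(τ) = t | L_𝒜(τ) = n] = P[r_h(τ*) = t]. -/

import Mathlib

open MeasureTheory Filter Set ProbabilityTheory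
open scoped ENNReal Topology

namespace GWLocal

/-- Nodes of trees: finite sequences of positive integers. -/
abbrev Node : Type := List ℕ+

/-- A (rooted planar) tree, as a subset of the set `U` of finite sequences of positive
integers: it contains the root `[]`, is closed under taking prefixes, and the children of
any node `u` form an initial segment `u1, …, uk` for some `k ∈ ℤ₊` (the out-degree of `u`). -/
def IsTree (t : Set Node) : Prop :=
  (([] : Node) ∈ t) ∧
  (∀ u ∈ t, ∀ v : Node, v <+: u → v ∈ t) ∧
  (∀ u ∈ t, ∃ k : ℕ, ∀ i : ℕ+, (u ++ [i]) ∈ t ↔ (i : ℕ) ≤ k)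

/-- The out-degree `k_u(t)` of the node `u` in the tree `t`. -/
noncomputable def deg (t : Set Node) (u : Node) : ℕ := {i : ℕ+ | (u ++ [i]) ∈ t}.ncard

/-- `restrict h t = r_h(t)`, the tree `t` restricted below height `h`. -/
def restrict (h : ℕ) (t : Set Node) : Set Node := {u ∈ t | u.length ≤ h}

/-- `Y h t = Y_h(t)`, the number of nodes of `t` at height `h`. -/
noncomputable def Y (h : ℕ) (t : Set Node) : ℕ := {u ∈ t | u.length = h}.ncard

/-- The height `H(t) = sup{|u| : u ∈ t}` of a tree. -/
noncomputable def height (t : Set Node) : ℕ∞ := ⨆ u ∈ t, (u.length : ℕ∞)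

/-- The width `W(t) = sup_{h ∈ ℤ₊} Y_h(t)` of a tree. -/
noncomputable def width (t : Set Node) : ℕ∞ := ⨆ h : ℕ, (Y h t : ℕ∞)

/-- The subtree of `t` above the node `u`, re-rooted at `u`. -/
def subtreeAt (t : Set Node) (u : Node) : Set Node := {v | u ++ v ∈ t}

/-- The mean `μ = Σ_k k p_k` of an offspring distribution `p`. -/
noncomputable def mean (p : PMF ℕ) : ℝ≥0∞ := ∑' k : ℕ, (k : ℝ≥0∞) * p k

/-- `∏_{u ∈ t, |u| < h} p_{k_u(t)}`: the probability that a GW tree with offspring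
distribution `p`, restricted below height `h`, equals `t`. -/
noncomputable def cylProb (p : PMF ℕ) (h : ℕ) (t : Set Node) : ℝ≥0∞ :=
  ∏ᶠ u ∈ {u ∈ t | u.length < h}, p (deg t u)

/-- `μ^{-b} Y_b(t) ∏_{u ∈ t, |u| < b} p_{k_u(t)}`: the probability that Kesten's immortal
tree `τ*` associated with `p`, restricted below height `b`, equals `t`. -/
noncomputable def kesten (p : PMF ℕ) (b : ℕ) (t : Set Node) : ℝ≥0∞ :=
  ((mean p)⁻¹) ^ b * (Y b t : ℝ≥0∞) * cylProb p b t

/-- The σ-algebra on the space of trees generated by the events `{t : r_h(t) = s}`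
(the Borel σ-algebra of the local ultrametric on trees). -/
def treeσ : MeasurableSpace (Set Node) :=
  MeasurableSpace.generateFrom
    {S : Set (Set Node) | ∃ (h : ℕ) (s : Set Node), S = {t | restrict h t = s}}

/-- `τ` is a Galton–Watson tree with offspring distribution `p` under `P`:
it takes values in trees, is measurable, and for every `h ∈ ℕ = {1,2,…}` and every tree `t`
of height at most `h`, `P[r_h(τ) = t] = ∏_{u ∈ t, |u| < h} p_{k_u(t)}`. -/
def IsGW {Ω : Type*} [MeasurableSpace Ω] (P : Measure Ω) (p : PMF ℕ)
    (τ : Ω → Set Node) : Prop :=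
  (∀ ω, IsTree (τ ω)) ∧ (@Measurable Ω (Set Node) _ treeσ τ) ∧
  (∀ h : ℕ, 1 ≤ h → ∀ t : Set Node, IsTree t → height t ≤ (h : ℕ∞) →
    P {ω | restrict h (τ ω) = t} = cylProb p h t)

/-- `L_𝒜(t)`: the number of nodes of `t` with out-degree in `𝒜`. -/
noncomputable def LA (𝒜 : Set ℕ) (t : Set Node) : ℕ := {u ∈ t | deg t u ∈ 𝒜}.ncard

/-! ### Expectations along a weighted random walk -/

section Walk

variable {S M : Type*} [AddCommMonoid M]

/-- The integral of `φ` against the law of `st j₁ + ⋯ + st jₙ`, where `j₁, …, jₙ` are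
independent with (not necessarily normalised) weights `w`. -/
noncomputable def walkExp (w : S → ℝ≥0∞) (st : S → M) : ℕ → (M → ℝ≥0∞) → ℝ≥0∞
  | 0, φ => φ 0
  | n + 1, φ => ∑' j, w j * walkExp w st n (fun x => φ (st j + x))

variable (w : S → ℝ≥0∞) (st : S → M)

@[simp] lemma walkExp_zero (φ : M → ℝ≥0∞) : walkExp w st 0 φ = φ 0 := rfl

lemma walkExp_succ (n : ℕ) (φ : M → ℝ≥0∞) :
    walkExp w st (n + 1) φ = ∑' j, w j * walkExp w st n (fun x => φ (st j + x)) := rfl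

lemma walkExp_one (φ : M → ℝ≥0∞) : walkExp w st 1 φ = ∑' j, w j * φ (st j) := by
  simp [walkExp]

lemma walkExp_mono (n : ℕ) {φ ψ : M → ℝ≥0∞} (h : ∀ x, φ x ≤ ψ x) :
    walkExp w st n φ ≤ walkExp w st n ψ := by
  induction n generalizing φ ψ with
  | zero => exact h 0
  | succ n ih =>
    exact ENNReal.tsum_le_tsum fun j => mul_le_mul_right (ih fun x => h _) _

lemma walkExp_tsum {ι : Type*} (n : ℕ) (φ : ι → M → ℝ≥0∞) :
    walkExp w st n (fun x => ∑' i, φ i x) = ∑' i, walkExp w st n (φ i) := by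
  induction n generalizing φ with
  | zero => rfl
  | succ n ih =>
    simp only [walkExp_succ]
    rw [ENNReal.tsum_comm]
    refine tsum_congr fun j => ?_
    rw [ih (fun i x => φ i (st j + x)), ENNReal.tsum_mul_left]

lemma walkExp_add_fun (n : ℕ) (φ ψ : M → ℝ≥0∞) :
    walkExp w st n (fun x => φ x + ψ x) = walkExp w st n φ + walkExp w st n ψ := by
  induction n generalizing φ ψ with
  | zero => rfl
  | succ n ih =>
    simp only [walkExp_succ]
    rw [← ENNReal.tsum_add]
    refine tsum_congr fun j => ?_
    rw [ih (fun x => φ (st j + x)) (fun x => ψ (st j + x)), mul_add]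

lemma walkExp_const_mul (n : ℕ) (c : ℝ≥0∞) (φ : M → ℝ≥0∞) :
    walkExp w st n (fun x => c * φ x) = c * walkExp w st n φ := by
  induction n generalizing φ with
  | zero => rfl
  | succ n ih =>
    simp only [walkExp_succ]
    rw [← ENNReal.tsum_mul_left]
    refine tsum_congr fun j => ?_
    rw [ih (fun x => φ (st j + x)), mul_left_comm]

lemma walkExp_add (n m : ℕ) (φ : M → ℝ≥0∞) :
    walkExp w st (n + m) φ =
      walkExp w st n (fun x => walkExp w st m (fun y => φ (x + y))) := by
  induction n generalizing φ with
  | zero => simp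
  | succ n ih =>
    rw [add_right_comm, walkExp_succ, walkExp_succ]
    refine tsum_congr fun j => ?_
    rw [ih]
    simp only [add_assoc]

lemma walkExp_map {M' : Type*} [AddCommMonoid M'] (g : M →+ M') (n : ℕ) (φ : M' → ℝ≥0∞) :
    walkExp w (fun j => g (st j)) n φ = walkExp w st n (fun x => φ (g x)) := by
  induction n generalizing φ with
  | zero => simp
  | succ n ih => simp only [walkExp_succ, ih, map_add]

lemma walkExp_mul {ψ : M → ℝ≥0∞} (h0 : ψ 0 = 1) (hadd : ∀ x y, ψ (x + y) = ψ x * ψ y)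
    (n : ℕ) : walkExp w st n ψ = (∑' j, w j * ψ (st j)) ^ n := by
  induction n with
  | zero => simpa using h0
  | succ n ih =>
    rw [walkExp_succ, pow_succ', ← ENNReal.tsum_mul_right]
    refine tsum_congr fun j => ?_
    simp only [hadd]
    rw [walkExp_const_mul, ih, mul_assoc]

/-- Exchangeability of the steps: the integral of an additive functional is the number of
steps times the contribution of the first one. -/
lemma walkExp_additive_mul (l : M →+ ℝ≥0∞) (n : ℕ) (φ : M → ℝ≥0∞) :
    walkExp w st (n + 1) (fun x => l x * φ x) =
      (n + 1 : ℕ) * ∑' j, w j * (l (st j) * walkExp w st n (fun x => φ (st j + x))) := by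
  induction n generalizing φ with
  | zero => simp [walkExp_one]
  | succ n ih =>
    have key : ∀ j, walkExp w st (n + 1) (fun x => l (st j + x) * φ (st j + x)) =
        l (st j) * walkExp w st (n + 1) (fun x => φ (st j + x)) +
        (n + 1 : ℕ) * ∑' i, w i *
          (l (st i) * walkExp w st n (fun x => φ (st j + (st i + x)))) := by
      intro j
      rw [← ih (fun x => φ (st j + x)), ← walkExp_const_mul, ← walkExp_add_fun]
      simp only [map_add, add_mul]
    rw [walkExp_succ]
    simp only [key, mul_add]
    rw [ENNReal.tsum_add]
    have swap : ∑' j, w j * ((n + 1 : ℕ) * ∑' i, w i *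
          (l (st i) * walkExp w st n (fun x => φ (st j + (st i + x))))) =
        (n + 1 : ℕ) * ∑' i, w i * (l (st i) * walkExp w st (n + 1) (fun x => φ (st i + x))) := by
      simp only [walkExp_succ, ← ENNReal.tsum_mul_left]
      rw [ENNReal.tsum_comm]
      refine tsum_congr fun i => tsum_congr fun j => ?_
      simp only [add_left_comm (st j) (st i)]
      ring
    rw [swap]
    push_cast
    ring

lemma pow_le_walkExp_indicator (j : S) (n : ℕ) :
    w j ^ n ≤ walkExp w st n (Set.indicator {n • st j} 1) := by
  induction n with
  | zero => simp
  | succ n ih =>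
    rw [walkExp_succ]
    refine le_trans ?_ (ENNReal.le_tsum j)
    rw [pow_succ']
    refine mul_le_mul_right (ih.trans (walkExp_mono _ _ _ fun x => ?_)) _
    by_cases hx : x = n • st j
    · simp [hx, succ_nsmul']
    · simp [hx]

lemma tsum_prod_eq_walkExp {ι : Type*} [Fintype ι] (ψ : M → ℝ≥0∞) :
    ∑' g : ι → S, (∏ i, w (g i)) * ψ (∑ i, st (g i)) = walkExp w st (Fintype.card ι) ψ := by
  have fin : ∀ (n : ℕ) (ψ : M → ℝ≥0∞), ∑' g : Fin n → S,
      (∏ i, w (g i)) * ψ (∑ i, st (g i)) = walkExp w st n ψ := by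
    intro n
    induction n with
    | zero => intro ψ; simp
    | succ n ih =>
      intro ψ
      rw [walkExp_succ, ← (Fin.consEquiv fun _ => S).tsum_eq, ENNReal.tsum_prod']
      refine tsum_congr fun j => ?_
      rw [← ih, ← ENNReal.tsum_mul_left]
      refine tsum_congr fun g => ?_
      simp [Fin.prod_univ_succ, Fin.sum_univ_succ, Fin.consEquiv, mul_assoc]
  rw [← fin, ← ((Fintype.equivFin ι).arrowCongr (Equiv.refl S)).tsum_eq]
  refine tsum_congr fun g => ?_
  congr 1
  · exact Fintype.prod_equiv (Fintype.equivFin ι) _ _ (by simp)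
  · congr 1
    exact Fintype.sum_equiv (Fintype.equivFin ι) _ _ (by simp)

/-- The law at time `n` of the walk on `ℤ` with step law `z`. -/
noncomputable def walkLaw (z : ℤ → ℝ≥0∞) (n : ℕ) (x : ℤ) : ℝ≥0∞ :=
  walkExp z id n (Set.indicator {x} 1)

end Walk

/-! ### Exploration of a forest -/

section Forest

variable (w : ℕ → ℝ≥0∞) (A : Set ℕ)

/-- The indicator function of `A`, with values in `ℕ`. -/
noncomputable def mark (j : ℕ) : ℕ := A.indicator 1 j

/-- The contribution of a node of out-degree `j` to the number of children and to the number
of nodes with out-degree in `A`. -/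
noncomputable def degStep (j : ℕ) : ℕ × ℕ := (j, mark A j)

/-- The integral of `φ (L_A)` on the event that a forest of `k` trees has height less
than `H`, computed generation by generation. -/
noncomputable def bfsExp : ℕ → ℕ → (ℕ → ℝ≥0∞) → ℝ≥0∞
  | 0, k, φ => if k = 0 then φ 0 else 0
  | H + 1, k, φ =>
    walkExp w (degStep A) k (fun x => bfsExp H x.1 (fun c => φ (x.2 + c)))

/-- The integral of `φ (L_A)` on the event that a forest of `k` trees has `m` nodes, computed
by exploring the nodes one by one. -/
noncomputable def dfsExp : ℕ → ℕ → (ℕ → ℝ≥0∞) → ℝ≥0∞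
  | 0, k, φ => if k = 0 then φ 0 else 0
  | _ + 1, 0, _ => 0
  | m + 1, k + 1, φ => ∑' j, w j * dfsExp m (k + j) (fun c => φ (mark A j + c))

/-- The integral of `φ (L_A)` on the event that a forest of `k` trees is finite. -/
noncomputable def forestExp (k : ℕ) (φ : ℕ → ℝ≥0∞) : ℝ≥0∞ := ∑' m, dfsExp w A m k φ

@[simp] lemma dfsExp_succ_zero (m : ℕ) (φ : ℕ → ℝ≥0∞) : dfsExp w A (m + 1) 0 φ = 0 := rfl

lemma dfsExp_succ_succ (m k : ℕ) (φ : ℕ → ℝ≥0∞) : dfsExp w A (m + 1) (k + 1) φ =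
    ∑' j, w j * dfsExp w A m (k + j) (fun c => φ (mark A j + c)) := rfl

lemma dfsExp_zero (k : ℕ) (φ : ℕ → ℝ≥0∞) :
    dfsExp w A 0 k φ = if k = 0 then φ 0 else 0 := rfl

lemma bfsExp_zero (k : ℕ) (φ : ℕ → ℝ≥0∞) :
    bfsExp w A 0 k φ = if k = 0 then φ 0 else 0 := rfl

lemma bfsExp_succ (H k : ℕ) (φ : ℕ → ℝ≥0∞) : bfsExp w A (H + 1) k φ =
    walkExp w (degStep A) k (fun x => bfsExp w A H x.1 (fun c => φ (x.2 + c))) := rfl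

@[simp] lemma bfsExp_zero_right (H : ℕ) (φ : ℕ → ℝ≥0∞) : bfsExp w A H 0 φ = φ 0 := by
  induction H generalizing φ with
  | zero => simp [bfsExp_zero]
  | succ H ih => simp [bfsExp_succ, ih]

lemma forestExp_zero (φ : ℕ → ℝ≥0∞) : forestExp w A 0 φ = φ 0 := by
  rw [forestExp, tsum_eq_zero_add' ENNReal.summable]
  simp [dfsExp_zero]

lemma forestExp_succ (k : ℕ) (φ : ℕ → ℝ≥0∞) : forestExp w A (k + 1) φ =
    ∑' j, w j * forestExp w A (k + j) (fun c => φ (mark A j + c)) := by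
  rw [forestExp, tsum_eq_zero_add' ENNReal.summable]
  simp only [dfsExp_zero, dfsExp_succ_succ, forestExp, ← ENNReal.tsum_mul_left]
  rw [ENNReal.tsum_comm]
  simp

lemma forestExp_add (k r : ℕ) (φ : ℕ → ℝ≥0∞) : forestExp w A (k + r) φ =
    walkExp w (degStep A) k (fun x => forestExp w A (x.1 + r) (fun c => φ (x.2 + c))) := by
  induction k generalizing r φ with
  | zero => simp
  | succ k ih =>
    rw [add_right_comm, forestExp_succ, walkExp_succ]
    refine tsum_congr fun j => ?_
    rw [add_assoc, add_comm r j, ih]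
    simp only [degStep, Prod.fst_add, Prod.snd_add, add_assoc, add_left_comm j]

lemma sum_dfsExp_succ (m k : ℕ) (φ : ℕ → ℝ≥0∞) :
    ∑ i ∈ Finset.range (m + 1), dfsExp w A i (k + 1) φ =
      ∑' j, w j * ∑ i ∈ Finset.range m, dfsExp w A i (k + j) (fun c => φ (mark A j + c)) := by
  rw [Finset.sum_range_succ']
  simp only [dfsExp_zero, dfsExp_succ_succ, Finset.mul_sum]
  rw [Summable.tsum_finsetSum fun _ _ => ENNReal.summable]
  simp

lemma sum_dfsExp_add (m k r : ℕ) (φ : ℕ → ℝ≥0∞) :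
    ∑ i ∈ Finset.range (m + k), dfsExp w A i (k + r) φ =
      walkExp w (degStep A) k (fun x =>
        ∑ i ∈ Finset.range m, dfsExp w A i (x.1 + r) (fun c => φ (x.2 + c))) := by
  induction k generalizing r φ with
  | zero => simp
  | succ k ih =>
    rw [add_right_comm k, ← add_assoc m, sum_dfsExp_succ, walkExp_succ]
    refine tsum_congr fun j => ?_
    rw [add_assoc, add_comm r j, ih]
    simp only [degStep, Prod.fst_add, Prod.snd_add, add_assoc, add_left_comm j]

lemma sum_dfsExp_le_bfsExp (m k : ℕ) (φ : ℕ → ℝ≥0∞) :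
    ∑ i ∈ Finset.range m, dfsExp w A i k φ ≤ bfsExp w A m k φ := by
  induction m generalizing k φ with
  | zero => simp
  | succ m ih =>
    rcases k with _ | k
    · rw [Finset.sum_range_succ']
      simp [dfsExp_zero]
    · calc ∑ i ∈ Finset.range (m + 1), dfsExp w A i (k + 1) φ
          ≤ ∑ i ∈ Finset.range (m + (k + 1)), dfsExp w A i (k + 1 + 0) φ :=
            Finset.sum_le_sum_of_subset (Finset.range_mono (by lia))
        _ ≤ bfsExp w A (m + 1) (k + 1) φ := by
            rw [sum_dfsExp_add, bfsExp_succ]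
            exact walkExp_mono _ _ _ fun x => ih _ _

lemma bfsExp_le_forestExp (H k : ℕ) (φ : ℕ → ℝ≥0∞) :
    bfsExp w A H k φ ≤ forestExp w A k φ := by
  induction H generalizing k φ with
  | zero =>
    rcases k with _ | k
    · simp [forestExp_zero]
    · simp [bfsExp_zero]
  | succ H ih =>
    rw [← add_zero k, forestExp_add, bfsExp_succ]
    exact walkExp_mono _ _ _ fun x => ih _ _

lemma iSup_bfsExp (k : ℕ) (φ : ℕ → ℝ≥0∞) : ⨆ H, bfsExp w A H k φ = forestExp w A k φ := by
  refine le_antisymm (iSup_le fun H => bfsExp_le_forestExp w A H k φ) ?_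
  rw [forestExp, ENNReal.tsum_eq_iSup_nat]
  exact iSup_mono fun m => sum_dfsExp_le_bfsExp w A m k φ

lemma bfsExp_const_mul (H k : ℕ) (a : ℝ≥0∞) (φ : ℕ → ℝ≥0∞) :
    bfsExp w A H k (fun c => a * φ c) = a * bfsExp w A H k φ := by
  induction H generalizing k φ with
  | zero => simp [bfsExp_zero]
  | succ H ih => simp only [bfsExp_succ, ih _ (fun c => φ (_ + c)), walkExp_const_mul]

lemma bfsExp_pow (H k : ℕ) (y : ℝ≥0∞) :
    bfsExp w A H k (fun c => y ^ c) = bfsExp w A H 1 (fun c => y ^ c) ^ k := by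
  induction H generalizing k with
  | zero => rcases k with _ | k <;> simp [bfsExp_zero]
  | succ H ih =>
    simp only [bfsExp_succ, pow_add, bfsExp_const_mul]
    rw [walkExp_mul, walkExp_mul, pow_one]
    any_goals simp
    all_goals
      intro x x' y' y''
      rw [ih (x + y'), ih x, ih y']
      ring

lemma forestExp_pow (k : ℕ) (y : ℝ≥0∞) :
    forestExp w A k (fun c => y ^ c) = forestExp w A 1 (fun c => y ^ c) ^ k := by
  rw [← iSup_bfsExp, ← iSup_bfsExp, ENNReal.iSup_pow]
  simp only [bfsExp_pow w A _ k]

lemma dfsExp_tsum {ι : Type*} (m k : ℕ) (φ : ι → ℕ → ℝ≥0∞) :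
    dfsExp w A m k (fun c => ∑' i, φ i c) = ∑' i, dfsExp w A m k (φ i) := by
  induction m generalizing k φ with
  | zero => by_cases hk : k = 0 <;> simp [dfsExp_zero, hk]
  | succ m ih =>
    rcases k with _ | k
    · simp
    · simp only [dfsExp_succ_succ, ih _ (fun i c => φ i (_ + c)), ← ENNReal.tsum_mul_left]
      rw [ENNReal.tsum_comm]

lemma dfsExp_const_mul (m k : ℕ) (a : ℝ≥0∞) (φ : ℕ → ℝ≥0∞) :
    dfsExp w A m k (fun c => a * φ c) = a * dfsExp w A m k φ := by
  induction m generalizing k φ with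
  | zero => simp [dfsExp_zero]
  | succ m ih =>
    rcases k with _ | k
    · simp
    · simp only [dfsExp_succ_succ, ih _ (fun c => φ (_ + c)), ← ENNReal.tsum_mul_left,
        mul_left_comm]

lemma forestExp_pow_eq_tsum (y : ℝ≥0∞) : forestExp w A 1 (fun c => y ^ c) =
    ∑' j, w j * (y ^ mark A j * forestExp w A 1 (fun c => y ^ c) ^ j) := by
  conv_lhs => rw [← zero_add 1, forestExp_succ]
  refine tsum_congr fun j => ?_
  rw [← forestExp_pow, zero_add]
  simp only [pow_add, forestExp, dfsExp_const_mul, ENNReal.tsum_mul_left]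

/-- The integral of a function of `L_A` in terms of the distribution of `L_A`. -/
lemma forestExp_eq_tsum (k : ℕ) (φ : ℕ → ℝ≥0∞) :
    forestExp w A k φ = ∑' n, φ n * forestExp w A k (Set.indicator {n} 1) := by
  have : φ = fun c => ∑' n, φ n * Set.indicator {n} 1 c := by
    ext c
    rw [tsum_eq_single c fun n hn => by simp [hn.symm]]
    simp
  conv_lhs => rw [this]
  simp only [forestExp, dfsExp_tsum, dfsExp_const_mul]
  rw [ENNReal.tsum_comm]
  simp only [ENNReal.tsum_mul_left]

/-- The hitting time theorem: for a walk started at `k` with steps `j - 1`, the probability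
to hit `0` at time `m` is `k / m` times the probability to be at `0` at time `m`. -/
lemma mul_dfsExp (m k : ℕ) (φ : ℕ → ℝ≥0∞) : m * dfsExp w A m k φ =
    k * walkExp w (degStep A) m (fun x => if x.1 + k = m then φ x.2 else 0) := by
  induction m generalizing k φ with
  | zero => rcases k with _ | k <;> simp
  | succ m ih =>
    rcases k with _ | k
    · simp
    rcases Nat.eq_zero_or_pos m with rfl | hm
    · simp only [dfsExp_succ_succ, walkExp_one, dfsExp_zero, zero_add, degStep]
      rcases k with _ | k
      · simp
      · simp [← add_assoc]
    set ψ : ℕ × ℕ → ℝ≥0∞ := fun x => if x.1 + (k + 1) = m + 1 then φ x.2 else 0 with hψ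
    have e : ∀ j, walkExp w (degStep A) m
        (fun x => if x.1 + (k + j) = m then φ (mark A j + x.2) else 0) =
        walkExp w (degStep A) m (fun x => ψ (degStep A j + x)) := by
      intro j
      congr 1
      ext x
      have : x.1 + (k + j) = m ↔ (degStep A j + x).1 + (k + 1) = m + 1 := by
        simp only [degStep, Prod.fst_add]; lia
      simp only [hψ, this]
      simp [degStep]
    let l : ℕ × ℕ →+ ℝ≥0∞ := (Nat.castAddMonoidHom ℝ≥0∞).comp (AddMonoidHom.fst ℕ ℕ)
    have h1 : (m : ℝ≥0∞) * ((m + 1 : ℕ) * dfsExp w A (m + 1) (k + 1) φ) =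
        m * ((k + 1 : ℕ) * walkExp w (degStep A) (m + 1) ψ) := by
      calc (m : ℝ≥0∞) * ((m + 1 : ℕ) * dfsExp w A (m + 1) (k + 1) φ)
          = (m + 1 : ℕ) * ∑' j, w j * ((m : ℝ≥0∞) *
              dfsExp w A m (k + j) (fun c => φ (mark A j + c))) := by
            rw [dfsExp_succ_succ, mul_left_comm, ← ENNReal.tsum_mul_left]
            simp only [mul_left_comm]
        _ = (m + 1 : ℕ) * (k * walkExp w (degStep A) (m + 1) ψ) +
              walkExp w (degStep A) (m + 1) (fun x => l x * ψ x) := by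
            rw [walkExp_additive_mul, ← mul_add]
            congr 1
            rw [walkExp_succ, ← ENNReal.tsum_mul_left, ← ENNReal.tsum_add]
            refine tsum_congr fun j => ?_
            rw [ih, e]
            simp only [l, degStep]
            simp
            ring
        _ = m * (k * walkExp w (degStep A) (m + 1) ψ) +
              walkExp w (degStep A) (m + 1) (fun x => m * ψ x) := by
            have : ∀ x, (k : ℝ≥0∞) * ψ x + l x * ψ x = m * ψ x := by
              intro x
              by_cases hx : x.1 + (k + 1) = m + 1
              · have : m = k + x.1 := by lia
                simp only [l, this]
                simp
                ring
              · simp [hψ, hx]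
            simp only [← this]
            rw [walkExp_add_fun, walkExp_const_mul]
            push_cast
            ring
        _ = m * ((k + 1 : ℕ) * walkExp w (degStep A) (m + 1) ψ) := by
            rw [walkExp_const_mul]
            push_cast
            ring
    exact (ENNReal.mul_right_inj (by positivity) (ENNReal.natCast_ne_top m)).1 h1

end Forest

/-! ### Criticality: extinction and absence of exponential moments -/

section Critical

lemma one_add_mul_sq_le_pow_add {q u : ℝ≥0∞} (h : q + u = 1) (j : ℕ) :
    1 + j * u ^ 2 ≤ q ^ (j + 1) + (j + 1 : ℕ) * u := by
  induction j with
  | zero => simp [h]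
  | succ j ih =>
    calc 1 + (j + 1 : ℕ) * u ^ 2 = q + ((j + 1 : ℕ) * u ^ 2 + u) := by
          rw [← h]; ring
      _ ≤ q * (q ^ (j + 1) + (j + 1 : ℕ) * u) + ((j + 1 : ℕ) * u ^ 2 + u) := by
          gcongr
          exact le_mul_of_one_le_right' (le_self_add.trans ih)
      _ = q ^ (j + 1 + 1) + ((j + 1 : ℕ) * ((q + u) * u) + u) := by ring
      _ = q ^ (j + 1 + 1) + (j + 1 + 1 : ℕ) * u := by
          rw [h]; push_cast; ring

variable {p : PMF ℕ} (A : Set ℕ)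

lemma exists_two_le_of_mean_eq_one (hp1 : p 1 < 1) (hcrit : mean p = 1) :
    ∃ k, 2 ≤ k ∧ p k ≠ 0 := by
  by_contra! h
  have : mean p = p 1 := by
    rw [mean, tsum_eq_single 1]
    · simp
    · rintro (_ | _ | b) hb
      · simp
      · simp at hb
      · simp [h (b + 1 + 1) (by lia)]
  rw [this] at hcrit
  exact hp1.ne hcrit

lemma bfsExp_one_le (H : ℕ) : bfsExp p A H 1 (fun _ => 1) ≤ 1 := by
  induction H with
  | zero => simp [bfsExp_zero]
  | succ H ih =>
    rw [bfsExp_succ, walkExp_one]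
    calc ∑' j, p j * bfsExp p A H (degStep A j).1 (fun _ => 1) ≤ ∑' j, p j * 1 := by
          refine ENNReal.tsum_le_tsum fun j => mul_le_mul_right ?_ _
          have := bfsExp_pow p A H (degStep A j).1 1
          simp only [one_pow] at this
          rw [this]
          exact pow_le_one₀ zero_le ih
      _ = 1 := by simp [p.tsum_coe]

/-- A critical Galton–Watson tree is almost surely finite. -/
lemma forestExp_one_eq_one (hp1 : p 1 < 1) (hcrit : mean p = 1) :
    forestExp p A 1 (fun _ => 1) = 1 := by
  set q := forestExp p A 1 (fun _ => 1) with hq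
  have hq1 : q ≤ 1 := by
    rw [hq, ← iSup_bfsExp]
    exact iSup_le (bfsExp_one_le A)
  have hfix : q = ∑' j, p j * q ^ j := by
    simpa only [one_pow, one_mul] using forestExp_pow_eq_tsum p A 1
  by_contra hne
  set u := 1 - q with hu
  have hqu : q + u = 1 := add_tsub_cancel_of_le hq1
  have hu0 : u ≠ 0 := by
    intro h0
    exact hne (by simpa [h0] using hqu)
  obtain ⟨k, hk, hpk⟩ := exists_two_le_of_mean_eq_one hp1 hcrit
  have hle : ∀ j, p j ≤ p j * (q ^ j + j * u) := by
    rintro (_ | j)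
    · simp
    · exact le_mul_of_one_le_right' (le_self_add.trans (one_add_mul_sq_le_pow_add hqu j))
  have hlt : p k < p k * (q ^ k + k * u) := by
    obtain ⟨j, rfl⟩ : ∃ j, k = j + 1 := ⟨k - 1, by lia⟩
    have h1 : (1 : ℝ≥0∞) < 1 + j * u ^ 2 := by
      refine ENNReal.lt_add_right ENNReal.one_ne_top ?_
      have : j ≠ 0 := by lia
      positivity
    calc p (j + 1) = p (j + 1) * 1 := (mul_one _).symm
      _ < _ := ENNReal.mul_lt_mul_right hpk (p.apply_ne_top _)
        (h1.trans_le (one_add_mul_sq_le_pow_add hqu j))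
  have := ENNReal.tsum_lt_tsum (by simp [p.tsum_coe]) hle hlt
  have hsum : ∑' j, p j * (q ^ j + j * u) = q + u := by
    simp only [mul_add]
    rw [ENNReal.tsum_add, ← hfix]
    congr 1
    calc ∑' j : ℕ, p j * (j * u) = mean p * u := by
          rw [mean, ← ENNReal.tsum_mul_right]
          exact tsum_congr fun j => by ring
      _ = u := by rw [hcrit, one_mul]
  rw [hsum, hqu, p.tsum_coe] at this
  exact lt_irrefl _ this

lemma tsum_mul_mark_pos (hA : 0 < ∑' k : A, p (k : ℕ)) : 0 < ∑' j, p j * mark A j := by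
  refine hA.trans_le ?_
  rw [tsum_subtype]
  refine ENNReal.tsum_le_tsum fun j => ?_
  by_cases hj : j ∈ A <;> simp [mark, hj]

/-- For a critical tree, `L_A` has no exponential moment. -/
lemma forestExp_pow_eq_top (hp1 : p 1 < 1) (hcrit : mean p = 1)
    (hA : 0 < ∑' k : A, p (k : ℕ)) {y : ℝ≥0∞} (hy : 1 < y) :
    forestExp p A 1 (fun c => y ^ c) = ∞ := by
  set F := forestExp p A 1 (fun c => y ^ c) with hF
  by_contra htop
  obtain ⟨v, rfl⟩ := exists_add_of_le hy.le
  have hv : v ≠ 0 := by rintro rfl; simp at hy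
  have hF1 : 1 ≤ F := by
    rw [← forestExp_one_eq_one A hp1 hcrit, hF, ← iSup_bfsExp, ← iSup_bfsExp]
    refine iSup_mono fun H => ?_
    have mono : ∀ (H k : ℕ) {φ ψ : ℕ → ℝ≥0∞}, (∀ c, φ c ≤ ψ c) →
        bfsExp p A H k φ ≤ bfsExp p A H k ψ := by
      intro H
      induction H with
      | zero => intro k φ ψ h; rcases k with _ | k <;> simp [bfsExp_zero, h]
      | succ H ih =>
        intro k φ ψ h
        exact walkExp_mono _ _ _ fun x => ih _ fun c => h _
    exact mono _ _ fun c => one_le_pow₀ hy.le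
  obtain ⟨u, hu⟩ := exists_add_of_le hF1
  have hle : 1 + u + v * ∑' j, p j * mark A j ≤ F := by
    rw [hF, forestExp_pow_eq_tsum, ← hF]
    calc 1 + u + v * ∑' j, p j * mark A j
        = ∑' j, p j * ((1 + j * u) + mark A j * v) := by
          simp only [mul_add, mul_one]
          rw [ENNReal.tsum_add, ENNReal.tsum_add, p.tsum_coe]
          congr 2
          · calc u = mean p * u := by rw [hcrit, one_mul]
              _ = _ := by
                rw [mean, ← ENNReal.tsum_mul_right]
                exact tsum_congr fun j => by ring
          · rw [← ENNReal.tsum_mul_left]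
            exact tsum_congr fun j => by ring
      _ ≤ ∑' j, p j * ((1 + v) ^ mark A j * F ^ j) := by
          refine ENNReal.tsum_le_tsum fun j => mul_le_mul_right ?_ _
          have hb : 1 + j * u ≤ F ^ j := by
            rw [hu]
            exact one_add_mul_le_pow_of_sq_nonneg zero_le zero_le zero_le j
          by_cases hj : j ∈ A
          · simp only [mark, hj, Set.indicator_of_mem, Pi.one_apply, Nat.cast_one, one_mul,
              pow_one, add_mul]
            exact add_le_add hb (le_mul_of_one_le_right' (one_le_pow₀ hF1))
          · simpa [mark, hj] using hb
  rw [← hu] at hle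
  have hpos : v * ∑' j, p j * mark A j ≠ 0 := mul_ne_zero hv (tsum_mul_mark_pos A hA).ne'
  exact (ENNReal.lt_add_right htop hpos).not_ge hle

end Critical

/-! ### The walk observed at the marked steps -/

section MarkedWalk

variable (w : ℕ → ℝ≥0∞) (A : Set ℕ)

/-- The step `j - 1` of the exploration walk at a node of out-degree `j`. -/
def walkStep (j : ℕ) : ℤ := (j : ℤ) - 1

/-- The law of the increment of the exploration walk between two successive visits of nodes
with out-degree in `A`. -/
noncomputable def markedLaw (y : ℤ) : ℝ≥0∞ :=
  ∑' j, A.indicator w j *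
    ∑' l, walkExp (Aᶜ.indicator w) walkStep l (fun x => Set.indicator {y} 1 (walkStep j + x))

/-- The exploration walk at time `m`, on the event that `n` nodes with out-degree in `A` have
been visited. -/
noncomputable def explExp (m n : ℕ) (φ : ℤ → ℝ≥0∞) : ℝ≥0∞ :=
  walkExp w (fun j => (walkStep j, mark A j)) m (fun x => if x.2 = n then φ x.1 else 0)

lemma tsum_markedLaw_mul (φ : ℤ → ℝ≥0∞) : ∑' y, markedLaw w A y * φ y =
    ∑' j, A.indicator w j *
      ∑' l, walkExp (Aᶜ.indicator w) walkStep l (fun x => φ (walkStep j + x)) := by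
  have hφ : ∀ x, φ x = ∑' y, φ y * Set.indicator {y} 1 x := by
    intro x
    rw [tsum_eq_single x fun y hy => by simp [hy.symm]]
    simp
  have : ∀ j l, walkExp (Aᶜ.indicator w) walkStep l (fun x => φ (walkStep j + x)) =
      ∑' y, φ y * walkExp (Aᶜ.indicator w) walkStep l
        (fun x => Set.indicator {y} 1 (walkStep j + x)) := by
    intro j l
    conv_lhs => enter [4, x]; rw [hφ (walkStep j + x)]
    rw [walkExp_tsum]
    simp only [walkExp_const_mul]
  simp only [this, markedLaw, ← ENNReal.tsum_mul_right, ← ENNReal.tsum_mul_left]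
  rw [ENNReal.tsum_comm]
  refine tsum_congr fun j => ?_
  rw [ENNReal.tsum_comm]
  exact tsum_congr fun l => tsum_congr fun y => by ring

variable {w A} in
lemma le_markedLaw {j k : ℕ} (hj : j ∈ A) (hk : k ∉ A) (l : ℕ) :
    w j * w k ^ l ≤ markedLaw w A (walkStep j + l * walkStep k) := by
  refine le_trans ?_ (ENNReal.le_tsum j)
  rw [Set.indicator_of_mem hj]
  refine mul_le_mul_right (le_trans ?_ (ENNReal.le_tsum l)) _
  have := pow_le_walkExp_indicator (Aᶜ.indicator w) walkStep k l
  rw [Set.indicator_of_mem (show k ∈ Aᶜ from hk)] at this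
  refine this.trans (walkExp_mono _ _ _ fun x => ?_)
  by_cases hx : x = l • walkStep k
  · simp [hx]
  · rw [Set.indicator_of_notMem (by simpa using hx)]
    exact zero_le

variable {w A} in
lemma le_markedLaw_walkStep {j : ℕ} (hj : j ∈ A) : w j ≤ markedLaw w A (walkStep j) := by
  refine le_trans ?_ (ENNReal.le_tsum j)
  rw [Set.indicator_of_mem hj]
  refine le_mul_of_one_le_right' (le_trans ?_ (ENNReal.le_tsum 0))
  simp

lemma explExp_succ_zero (m : ℕ) (φ : ℤ → ℝ≥0∞) : explExp w A (m + 1) 0 φ =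
    ∑' j, Aᶜ.indicator w j * explExp w A m 0 (fun y => φ (walkStep j + y)) := by
  rw [explExp, walkExp_succ]
  refine tsum_congr fun j => ?_
  by_cases hj : j ∈ A
  · have : (fun x : ℤ × ℕ => if ((walkStep j, mark A j) + x).2 = 0 then
        φ ((walkStep j, mark A j) + x).1 else 0) = fun x => 0 * (0 : ℝ≥0∞) := by
      ext x
      simp [mark, hj]
    rw [this, walkExp_const_mul]
    simp [hj]
  · simp [mark, hj, explExp]

lemma explExp_succ_succ (m n : ℕ) (φ : ℤ → ℝ≥0∞) : explExp w A (m + 1) (n + 1) φ =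
    ∑' j, A.indicator w j * explExp w A m n (fun y => φ (walkStep j + y)) +
    ∑' j, Aᶜ.indicator w j * explExp w A m (n + 1) (fun y => φ (walkStep j + y)) := by
  rw [explExp, walkExp_succ, ← ENNReal.tsum_add]
  refine tsum_congr fun j => ?_
  by_cases hj : j ∈ A
  · simp [mark, hj, explExp, add_comm 1]
  · simp [mark, hj, explExp]

lemma explExp_zero_eq (m : ℕ) (φ : ℤ → ℝ≥0∞) :
    explExp w A m 0 φ = walkExp (Aᶜ.indicator w) walkStep m φ := by
  induction m generalizing φ with
  | zero => simp [explExp]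
  | succ m ih => simp only [explExp_succ_zero, ih, walkExp_succ]

/-- Decomposition of the exploration walk at its first marked step. -/
lemma explExp_first_mark (m n : ℕ) (φ : ℤ → ℝ≥0∞) : explExp w A (m + 1) (n + 1) φ =
    ∑ i ∈ Finset.HasAntidiagonal.antidiagonal m, walkExp (Aᶜ.indicator w) walkStep i.1 (fun x =>
      ∑' j, A.indicator w j * explExp w A i.2 n (fun y => φ (walkStep j + x + y))) := by
  induction m generalizing φ with
  | zero =>
    rw [explExp_succ_succ]
    have : ∀ φ, explExp w A 0 (n + 1) φ = 0 := fun φ => by simp [explExp]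
    simp [this]
  | succ m ih =>
    rw [explExp_succ_succ, Finset.Nat.antidiagonal_succ, Finset.sum_cons, Finset.sum_map]
    congr 1
    · simp
    · simp only [ih, Finset.mul_sum]
      rw [Summable.tsum_finsetSum fun _ _ => ENNReal.summable]
      refine Finset.sum_congr rfl fun i _ => ?_
      simp only [Function.Embedding.prodMap, Function.Embedding.coeFn_mk, Prod.map_fst,
        Prod.map_snd, walkExp_succ, Function.Embedding.refl_apply]
      refine tsum_congr fun k => ?_
      simp only [add_assoc, add_left_comm (walkStep k)]

lemma tsum_antidiagonal (f : ℕ × ℕ → ℝ≥0∞) :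
    ∑' m, ∑ i ∈ Finset.HasAntidiagonal.antidiagonal m, f i = ∑' i, f i := by
  rw [← Finset.HasAntidiagonal.sigmaAntidiagonalEquivProd.tsum_eq, ENNReal.tsum_sigma']
  refine tsum_congr fun m => ?_
  rw [tsum_fintype, ← Finset.sum_coe_sort]
  rfl

lemma tsum_explExp (n : ℕ) (φ : ℤ → ℝ≥0∞) : ∑' m, explExp w A m n φ =
    walkExp (markedLaw w A) id n
      (fun x => ∑' l, walkExp (Aᶜ.indicator w) walkStep l (fun y => φ (x + y))) := by
  induction n generalizing φ with
  | zero => simp [explExp_zero_eq]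
  | succ n ih =>
    rw [tsum_eq_zero_add' ENNReal.summable]
    have h0 : explExp w A 0 (n + 1) φ = 0 := by simp [explExp]
    simp only [h0, zero_add, explExp_first_mark]
    rw [tsum_antidiagonal, ENNReal.tsum_prod', walkExp_succ]
    have h1 : ∀ l, ∑' b, walkExp (Aᶜ.indicator w) walkStep l (fun x =>
          ∑' j, A.indicator w j * explExp w A b n (fun y => φ (walkStep j + x + y))) =
        ∑' j, A.indicator w j * walkExp (Aᶜ.indicator w) walkStep l (fun x =>
          walkExp (markedLaw w A) id n
            (fun x' => ∑' l, walkExp (Aᶜ.indicator w) walkStep l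
              (fun y => φ (walkStep j + x + (x' + y))))) := by
      intro l
      rw [← walkExp_tsum]
      simp only [← walkExp_const_mul]
      rw [← walkExp_tsum]
      congr 1
      ext x
      rw [ENNReal.tsum_comm]
      refine tsum_congr fun j => ?_
      rw [ENNReal.tsum_mul_left, ih, walkExp_const_mul]
    simp only [h1]
    rw [ENNReal.tsum_comm]
    simp only [id, ENNReal.tsum_mul_left, add_assoc]
    rw [tsum_markedLaw_mul]
    simp only [add_assoc]

lemma walkExp_degStep_eq (m : ℕ) (φ : ℤ × ℕ → ℝ≥0∞) :
    walkExp w (degStep A) m (fun x => φ ((x.1 : ℤ) - m, x.2)) =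
      walkExp w (fun j => (walkStep j, mark A j)) m φ := by
  induction m generalizing φ with
  | zero => simp; rfl
  | succ m ih =>
    rw [walkExp_succ, walkExp_succ]
    refine tsum_congr fun j => ?_
    rw [← ih]
    congr 2
    ext x
    simp only [degStep, walkStep, Prod.fst_add, Prod.snd_add, Prod.mk_add_mk]
    congr 2
    push_cast
    ring

/-- The distribution of `L_A` for a forest of `k` trees, in terms of the walk observed at the
marked steps. -/
lemma mul_forestExp (k n : ℕ) : (n + 1 : ℕ) * forestExp w A k (Set.indicator {n + 1} 1) =
    k * walkLaw (markedLaw w A) (n + 1) (-k) := by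
  have hd : ∀ m, (n + 1 : ℕ) * dfsExp w A (m + 1) k (Set.indicator {n + 1} 1) =
      k * ∑' j, A.indicator w j *
        explExp w A m n (fun y => Set.indicator {-(k : ℤ)} 1 (walkStep j + y)) := by
    intro m
    let l : ℕ × ℕ →+ ℝ≥0∞ := (Nat.castAddMonoidHom ℝ≥0∞).comp (AddMonoidHom.snd ℕ ℕ)
    set ψ : ℕ × ℕ → ℝ≥0∞ := fun x =>
      if x.1 + k = m + 1 then Set.indicator {n + 1} 1 x.2 else 0 with hψ
    have hl : ∀ x, l x * ψ x = (n + 1 : ℕ) * ψ x := by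
      intro x
      by_cases hx : x.2 = n + 1
      · simp [l, hx]
      · simp [hψ, hx]
    have hstep : ∀ j, w j * (l (degStep A j) *
          walkExp w (degStep A) m (fun x => ψ (degStep A j + x))) =
        A.indicator w j *
          explExp w A m n (fun y => Set.indicator {-(k : ℤ)} 1 (walkStep j + y)) := by
      intro j
      by_cases hj : j ∈ A
      · rw [explExp, ← walkExp_degStep_eq]
        have : (l (degStep A j)) = 1 := by simp [l, degStep, mark, hj]
        rw [this, one_mul, Set.indicator_of_mem hj]
        congr 2
        ext x
        have h1 : (degStep A j + x).1 + k = m + 1 ↔ walkStep j + ((x.1 : ℤ) - m) = -k := by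
          simp only [degStep, walkStep, Prod.fst_add]; lia
        have h2 : (degStep A j + x).2 = n + 1 ↔ x.2 = n := by
          simp only [degStep, mark, hj, Prod.snd_add, Set.indicator_of_mem, Pi.one_apply]; lia
        simp only [hψ, h1, Set.indicator_apply, Set.mem_singleton_iff, h2, Pi.one_apply]
        split_ifs <;> rfl
      · have : (l (degStep A j)) = 0 := by simp [l, degStep, mark, hj]
        simp [this, hj]
    have := walkExp_additive_mul w (degStep A) l m ψ
    simp only [hl, hstep] at this
    rw [walkExp_const_mul] at this
    refine (ENNReal.mul_right_inj (a := ((m + 1 : ℕ) : ℝ≥0∞)) (by positivity)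
      (ENNReal.natCast_ne_top _)).1 ?_
    rw [mul_left_comm, mul_dfsExp, mul_left_comm, this, mul_left_comm]
  have h0 : dfsExp w A 0 k (Set.indicator {n + 1} 1) = 0 := by simp [dfsExp_zero]
  rw [forestExp, tsum_eq_zero_add' ENNReal.summable, h0, zero_add, ← ENNReal.tsum_mul_left]
  simp only [hd]
  rw [ENNReal.tsum_mul_left, ENNReal.tsum_comm, walkLaw, walkExp_add]
  simp only [walkExp_one, ENNReal.tsum_mul_left, tsum_explExp, id, tsum_markedLaw_mul]
  congr 1
  simp only [← walkExp_const_mul]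
  rw [← walkExp_tsum]
  simp only [add_left_comm]

end MarkedWalk

/-! ### The strong ratio limit theorem -/

section Ratio

variable {z : ℤ → ℝ≥0∞}

lemma walkLaw_one (x : ℤ) : walkLaw z 1 x = z x := by
  rw [walkLaw, walkExp_one, tsum_eq_single x fun y hy => by simp [hy]]
  simp

lemma walkLaw_mul_le (n m : ℕ) (x y : ℤ) :
    walkLaw z n x * walkLaw z m y ≤ walkLaw z (n + m) (x + y) := by
  rw [mul_comm, walkLaw, walkLaw, walkLaw, walkExp_add, ← walkExp_const_mul]
  refine walkExp_mono _ _ _ fun u => ?_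
  by_cases hu : u = x
  · subst hu
    simp only [Set.mem_singleton_iff, Set.indicator_of_mem, Pi.one_apply, mul_one]
    refine walkExp_mono _ _ _ fun v => ?_
    by_cases hv : v = y
    · simp [hv]
    · rw [Set.indicator_of_notMem (by simpa using hv)]
      exact zero_le
  · simp [hu]

lemma walkLaw_pow_le (n k : ℕ) (x : ℤ) : walkLaw z n x ^ k ≤ walkLaw z (k * n) (k * x) := by
  induction k with
  | zero => simp [walkLaw]
  | succ k ih =>
    calc walkLaw z n x ^ (k + 1) ≤ walkLaw z (k * n) (k * x) * walkLaw z n x := by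
          rw [pow_succ]
          exact mul_le_mul_left ih _
      _ ≤ walkLaw z ((k + 1) * n) ((k + 1 : ℕ) * x) := by
          refine (walkLaw_mul_le _ _ _ _).trans_eq ?_
          congr 1
          · ring
          · push_cast; ring

variable (hz : ∑' y, z y = 1)
include hz

lemma walkLaw_le_one (n : ℕ) (x : ℤ) : walkLaw z n x ≤ 1 := by
  calc walkLaw z n x ≤ walkExp z id n (fun _ => 1) :=
        walkExp_mono _ _ _ fun y => Set.indicator_apply_le' (fun _ => le_rfl) fun _ => zero_le
    _ = 1 := by
        rw [walkExp_mul _ _ rfl (fun _ _ => (one_mul 1).symm)]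
        simp [hz]

lemma walkLaw_ne_top (n : ℕ) (x : ℤ) : walkLaw z n x ≠ ∞ :=
  ((walkLaw_le_one hz n x).trans_lt ENNReal.one_lt_top).ne

omit hz in
/-- Return probabilities which are large at one time decay slowly along all possible times. -/
lemma exists_mul_pow_le_walkLaw {q : ℝ≥0∞} (hq : q ≤ 1) {m : ℕ} (hm : 0 < m)
    (h : q ^ m ≤ walkLaw z m 0) (x : ℤ) :
    ∃ C : ℝ≥0∞, C ≠ 0 ∧ ∀ n, walkLaw z n x ≠ 0 → C * q ^ n ≤ walkLaw z n x := by
  have hres : ∀ i : ℕ, ∃ C : ℝ≥0∞, 0 < C ∧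
      ∀ n, n % m = i → walkLaw z n x ≠ 0 → C * q ^ n ≤ walkLaw z n x := by
    intro i
    by_cases hex : ∃ n, n % m = i ∧ walkLaw z n x ≠ 0
    · classical
      refine ⟨walkLaw z (Nat.find hex) x, pos_iff_ne_zero.2 (Nat.find_spec hex).2, ?_⟩
      intro n hn hx
      have hle := Nat.find_min' hex ⟨hn, hx⟩
      have hmod : Nat.find hex % m = i := (Nat.find_spec hex).1
      set s := Nat.find hex
      obtain ⟨t, ht⟩ : m ∣ n - s :=
        (Nat.modEq_iff_dvd' hle).1 (hmod.trans hn.symm)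
      have hns : n = s + t * m := by
        rw [mul_comm t, ← ht]; lia
      calc walkLaw z s x * q ^ n ≤ walkLaw z s x * walkLaw z m 0 ^ t := by
            refine mul_le_mul_right ?_ _
            calc q ^ n ≤ q ^ (m * t) := pow_le_pow_right_of_le_one' hq (by lia)
              _ = (q ^ m) ^ t := pow_mul _ _ _
              _ ≤ walkLaw z m 0 ^ t := pow_le_pow_left' h t
        _ ≤ walkLaw z s x * walkLaw z (t * m) (t * 0) := by
            gcongr
            exact walkLaw_pow_le m t 0
        _ ≤ walkLaw z n x := by
            refine (walkLaw_mul_le _ _ _ _).trans_eq ?_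
            rw [mul_zero, add_zero, hns]
    · exact ⟨1, one_pos, fun n hn hx => absurd ⟨n, hn, hx⟩ hex⟩
  choose C hC0 hC using hres
  refine ⟨(Finset.range m).inf C, ?_, fun n hx => ?_⟩
  · refine ((Finset.lt_inf_iff (by simp)).2 fun i _ => hC0 i).ne'
  · refine le_trans ?_ (hC (n % m) n rfl hx)
    gcongr
    exact Finset.inf_le (Finset.mem_range.2 (Nat.mod_lt n hm))

variable (hpos : ∃ r b, 1 ≤ b ∧ walkLaw z r b ≠ 0)
  (hdiv : ∀ y : ℝ≥0∞, 1 < y → ∑' n : ℕ, walkLaw z (n + 1) (-1) * y ^ (n + 1) = ∞)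
include hpos hdiv

omit hz in
lemma exists_pow_le_walkLaw_zero {s : ℝ≥0∞} (hs0 : s ≠ 0) (hs : s < 1) :
    ∃ m, 0 < m ∧ (s ^ 2) ^ m ≤ walkLaw z m 0 := by
  obtain ⟨r, b, hb, hrb⟩ := hpos
  obtain ⟨n₀, hn₀⟩ : ∃ n, walkLaw z n (-1) ≠ 0 := by
    by_contra! h
    simpa [h] using hdiv 2 (by norm_num)
  obtain ⟨k, rfl⟩ : ∃ k : ℕ, b = 1 + k := ⟨(b - 1).toNat, by lia⟩
  obtain ⟨r', hr'⟩ : ∃ r', walkLaw z r' 1 ≠ 0 := by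
    refine ⟨r + k * n₀, ?_⟩
    have := walkLaw_mul_le (z := z) r (k * n₀) (1 + k) (k * (-1))
    rw [show (1 + k : ℤ) + k * (-1) = 1 by ring] at this
    refine (lt_of_lt_of_le ?_ this).ne'
    exact ENNReal.mul_pos hrb ((ENNReal.pow_pos (pos_iff_ne_zero.2 hn₀) k).trans_le
      (walkLaw_pow_le _ _ _)).ne'
  by_contra! hcon
  have hs_ne_top : s ≠ ∞ := (hs.trans ENNReal.one_lt_top).ne
  have hbound : walkLaw z r' 1 * ∑' n : ℕ, walkLaw z (n + 1) (-1) * s⁻¹ ^ (n + 1) ≤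
      ∑' n : ℕ, s ^ n := by
    rw [← ENNReal.tsum_mul_left]
    refine ENNReal.tsum_le_tsum fun n => ?_
    have h1 := walkLaw_mul_le (z := z) r' (n + 1) 1 (-1)
    rw [add_neg_cancel] at h1
    calc walkLaw z r' 1 * (walkLaw z (n + 1) (-1) * s⁻¹ ^ (n + 1))
        ≤ (s ^ 2) ^ (r' + (n + 1)) * s⁻¹ ^ (n + 1) := by
          rw [← mul_assoc]
          gcongr
          exact h1.trans (hcon _ (by lia)).le
      _ ≤ s ^ (n + (n + 1)) * s⁻¹ ^ (n + 1) := by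
          rw [← pow_mul]
          gcongr ?_ * _
          exact pow_le_pow_right_of_le_one' hs.le (by lia)
      _ = s ^ n := by
          rw [pow_add, mul_assoc, ← mul_pow, ENNReal.mul_inv_cancel hs0 hs_ne_top, one_pow, mul_one]
  rw [hdiv _ (ENNReal.one_lt_inv.2 hs), ENNReal.mul_top hr', ENNReal.tsum_geometric,
    top_le_iff, ENNReal.inv_eq_top, tsub_eq_zero_iff_le] at hbound
  exact hs.not_ge hbound

/-- The probabilities `P(Sₙ = x)` decay subexponentially along the possible times. -/
lemma exists_mul_exp_le_walkLaw {ε : ℝ} (hε : 0 < ε) (x : ℤ) :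
    ∃ C : ℝ, 0 < C ∧ ∀ n : ℕ, walkLaw z n x ≠ 0 →
      C * Real.exp (-(ε * n)) ≤ (walkLaw z n x).toReal := by
  set s := ENNReal.ofReal (Real.exp (-(ε / 2))) with hs
  have hs1 : s < 1 := by
    rw [hs, ENNReal.ofReal_lt_one, Real.exp_lt_one_iff]
    linarith
  obtain ⟨m, hm, hle⟩ := exists_pow_le_walkLaw_zero hpos hdiv
    (s := s) (by simpa [hs] using Real.exp_pos _) hs1
  obtain ⟨C, hC0, hC⟩ := exists_mul_pow_le_walkLaw (pow_le_one' hs1.le 2) hm hle x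
  refine ⟨(min C 1).toReal, ENNReal.toReal_pos ?_ ?_, fun n hn => ?_⟩
  · simp [hC0]
  · simp
  have h := ENNReal.toReal_mono (walkLaw_ne_top hz n x)
    ((mul_le_mul_left (min_le_left C 1) _).trans (hC n hn))
  rw [ENNReal.toReal_mul, ← pow_mul, ENNReal.toReal_pow, hs,
    ENNReal.toReal_ofReal (Real.exp_pos _).le, ← Real.exp_nat_mul] at h
  convert h using 3
  push_cast
  ring

omit hpos hdiv

/-- A convexity bound for the number of steps equal to `a` on the event `Sₙ₊₁ = x`. -/
lemma walkLaw_mul_exp_le (a x : ℤ) (n : ℕ) (θ : ℝ) (hx : walkLaw z (n + 1) x ≠ 0) :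
    (walkLaw z (n + 1) x).toReal * Real.exp (θ * ((n + 1 : ℕ) * (z a).toReal *
      ((walkLaw z n (x - a)).toReal / (walkLaw z (n + 1) x).toReal))) ≤
    Real.exp ((n + 1 : ℕ) * ((z a).toReal * (Real.exp θ - 1))) := by
  set N := n + 1 with hN
  set c : ℤ → ℕ := Set.indicator {a} 1 with hc
  set J : (ℤ × ℕ → ℝ≥0∞) → ℝ≥0∞ := walkExp z (fun y => (y, c y)) N with hJ
  set one : ℤ × ℕ → ℝ≥0∞ := fun u => Set.indicator {x} 1 u.1 with hone
  have hzt : ∀ y, z y ≠ ∞ := fun y =>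
    ((ENNReal.le_tsum y).trans_lt (hz ▸ ENNReal.one_lt_top)).ne
  have hone_le : ∀ u, one u ≤ 1 := fun u =>
    Set.indicator_apply_le' (fun _ => le_rfl) fun _ => zero_le
  have hJ0 : J one = walkLaw z N x :=
    (walkExp_map z (fun y => (y, c y)) (AddMonoidHom.fst ℤ ℕ) N (Set.indicator {x} 1)).symm
  have hJ1 : J (fun u => u.2 * one u) = N * (z a * walkLaw z n (x - a)) := by
    have := walkExp_additive_mul z (fun y => (y, c y))
      ((Nat.castAddMonoidHom ℝ≥0∞).comp (AddMonoidHom.snd ℤ ℕ)) n one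
    refine this.trans ?_
    congr 1
    rw [tsum_eq_single a fun y hy => by simp [hc, hy]]
    simp only [hc, AddMonoidHom.coe_comp, Function.comp_apply, AddMonoidHom.coe_snd,
      Set.mem_singleton_iff, Set.indicator_of_mem, Pi.one_apply, Nat.coe_castAddMonoidHom,
      Nat.cast_one, one_mul]
    congr 1
    rw [walkLaw]
    refine Eq.trans ?_ (walkExp_map z (fun y => (y, c y)) (AddMonoidHom.fst ℤ ℕ) n
      (Set.indicator {x - a} 1)).symm
    congr 1
    ext u
    simp only [hone, Set.indicator_apply, Set.mem_singleton_iff, AddMonoidHom.coe_fst,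
      Prod.fst_add, eq_sub_iff_add_eq', Pi.one_apply]
  have hJs : J (fun u => ENNReal.ofReal (Real.exp (θ * u.2)) * one u) ≤
      ENNReal.ofReal (Real.exp (N * ((z a).toReal * (Real.exp θ - 1)))) := by
    calc J (fun u => ENNReal.ofReal (Real.exp (θ * u.2)) * one u)
        ≤ J (fun u => ENNReal.ofReal (Real.exp (θ * u.2))) :=
          walkExp_mono _ _ _ fun u => mul_le_of_le_one_right' (hone_le u)
      _ = (∑' y, z y * ENNReal.ofReal (Real.exp (θ * c y))) ^ N := by
          rw [hJ, walkExp_mul]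
          · simp
          · intro u v
            rw [← ENNReal.ofReal_mul (Real.exp_pos _).le, ← Real.exp_add]
            simp [mul_add]
      _ ≤ ENNReal.ofReal (Real.exp ((z a).toReal * (Real.exp θ - 1))) ^ N := by
          gcongr
          have hsum : ∑' y, z y * ENNReal.ofReal (Real.exp (θ * c y)) + z a =
              1 + z a * ENNReal.ofReal (Real.exp θ) := by
            have hite : ∀ f : ℤ → ℝ≥0∞, ∑' y, f y = f a + ∑' y, if y = a then 0 else f y :=
              fun f => by convert ENNReal.tsum_eq_add_tsum_ite a
            have h3 : ∀ y, (if y = a then 0 else z y * ENNReal.ofReal (Real.exp (θ * c y))) =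
                if y = a then 0 else z y := by
              intro y
              split_ifs with hy
              · rfl
              · simp [hc, hy]
            rw [hite, tsum_congr h3, ← hz, hite z]
            simp only [hc, Set.mem_singleton_iff, Set.indicator_of_mem, Pi.one_apply,
              Nat.cast_one, mul_one]
            ring
          have hreal : ∑' y, z y * ENNReal.ofReal (Real.exp (θ * c y)) + z a ≤
              ENNReal.ofReal (Real.exp ((z a).toReal * (Real.exp θ - 1))) + z a := by
            rw [hsum, ← ENNReal.ofReal_toReal (hzt a), ← ENNReal.ofReal_mul (by positivity),
              ← ENNReal.ofReal_one, ← ENNReal.ofReal_add (by positivity) (by positivity),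
              ← ENNReal.ofReal_add (by positivity) (by positivity),
              ENNReal.toReal_ofReal (by positivity)]
            refine ENNReal.ofReal_le_ofReal ?_
            have := Real.add_one_le_exp ((z a).toReal * (Real.exp θ - 1))
            linarith
          exact (ENNReal.add_le_add_iff_right (hzt a)).1 hreal
      _ = _ := by
          rw [← ENNReal.ofReal_pow (Real.exp_pos _).le, ← Real.exp_nat_mul]
  set E₀ := (walkLaw z N x).toReal with hE₀
  have hE₀pos : 0 < E₀ := ENNReal.toReal_pos hx (walkLaw_ne_top hz _ _)
  set E₁ : ℝ := N * ((z a).toReal * (walkLaw z n (x - a)).toReal) with hE₁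
  set m := (N : ℝ) * (z a).toReal * ((walkLaw z n (x - a)).toReal / E₀) with hm
  have hE₁m : E₁ = m * E₀ := by
    rw [hm, hE₁]; field_simp
  set K := Real.exp (θ * m) with hK
  have hm0 : 0 ≤ m := by positivity
  have hE₀' : J one = ENNReal.ofReal E₀ := by
    rw [hJ0, ENNReal.ofReal_toReal (walkLaw_ne_top hz _ _)]
  have hE₁' : J (fun u => u.2 * one u) = ENNReal.ofReal E₁ := by
    rw [hJ1, hE₁, ENNReal.ofReal_mul (by positivity), ENNReal.ofReal_mul (by positivity),
      ENNReal.ofReal_natCast, ENNReal.ofReal_toReal (hzt a),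
      ENNReal.ofReal_toReal (walkLaw_ne_top hz _ _)]
  have hlin : ∀ a₀ a₁ : ℝ, 0 ≤ a₀ → 0 ≤ a₁ →
      J (fun u => ENNReal.ofReal (a₀ + a₁ * u.2) * one u) =
        ENNReal.ofReal (a₀ * E₀ + a₁ * E₁) := by
    intro a₀ a₁ h₀ h₁
    have : (fun u : ℤ × ℕ => ENNReal.ofReal (a₀ + a₁ * u.2) * one u) =
        fun u => ENNReal.ofReal a₀ * one u + ENNReal.ofReal a₁ * (u.2 * one u) := by
      ext u
      rw [ENNReal.ofReal_add h₀ (by positivity), ENNReal.ofReal_mul h₁, ENNReal.ofReal_natCast]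
      ring
    rw [this, hJ, walkExp_add_fun, walkExp_const_mul, walkExp_const_mul, ← hJ, hE₀', hE₁',
      ENNReal.ofReal_add (by positivity) (by positivity), ENNReal.ofReal_mul h₀,
      ENNReal.ofReal_mul h₁]
  set B := Real.exp (N * ((z a).toReal * (Real.exp θ - 1))) with hB
  have hpt : ∀ i : ℕ, K * (1 + θ⁻ * m) + K * θ⁺ * i ≤
      Real.exp (θ * i) + (K * (θ⁺ * m) + K * θ⁻ * i) := by
    intro i
    have h1 : K * (θ * (i - m) + 1) ≤ Real.exp (θ * i) := by
      calc K * (θ * (i - m) + 1) ≤ K * Real.exp (θ * (i - m)) := by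
            gcongr
            exact Real.add_one_le_exp _
        _ = Real.exp (θ * i) := by
            rw [hK, ← Real.exp_add]
            congr 1
            ring
    have h2 : θ = θ⁺ - θ⁻ := (posPart_sub_negPart θ).symm
    have h3 : K * (θ * (i - m) + 1) = K * (1 + θ⁻ * m) + K * θ⁺ * i -
        (K * (θ⁺ * m) + K * θ⁻ * i) := by
      conv_lhs => rw [h2]
      ring
    linarith
  have hp0 : 0 ≤ θ⁺ := posPart_nonneg θ
  have hn0 : 0 ≤ θ⁻ := negPart_nonneg θ
  have hK0 : 0 < K := Real.exp_pos _
  have hfin : ENNReal.ofReal (K * (1 + θ⁻ * m) * E₀ + K * θ⁺ * E₁) ≤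
      ENNReal.ofReal (B + (K * (θ⁺ * m) * E₀ + K * θ⁻ * E₁)) := by
    rw [← hlin _ _ (by positivity) (by positivity), ENNReal.ofReal_add (Real.exp_pos _).le
      (by positivity), ← hlin _ _ (by positivity) (by positivity)]
    refine le_trans ?_ (add_le_add_left hJs _)
    rw [hJ, ← walkExp_add_fun]
    refine walkExp_mono _ _ _ fun u => ?_
    rw [← add_mul, ← ENNReal.ofReal_add (Real.exp_pos _).le (by positivity)]
    exact mul_le_mul_left (ENNReal.ofReal_le_ofReal (hpt u.2)) _
  rw [ENNReal.ofReal_le_ofReal_iff (by positivity), hE₁m] at hfin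
  linarith

include hpos hdiv in
/-- The strong ratio limit theorem, for a shift by a possible step. -/
lemma tendsto_walkLaw_ratio {a : ℤ} (ha : z a ≠ 0) (x : ℤ) :
    Tendsto (fun n : ℕ => (walkLaw z (n - 1) (x - a)).toReal / (walkLaw z n x).toReal)
      (atTop ⊓ 𝓟 {n | walkLaw z n x ≠ 0}) (𝓝 1) := by
  have hα : 0 < (z a).toReal := ENNReal.toReal_pos ha
    ((ENNReal.le_tsum a).trans_lt (hz ▸ ENNReal.one_lt_top)).ne
  set α := (z a).toReal with hαdef
  have main : ∀ θ : ℝ, θ ≠ 0 → |θ| ≤ 1 →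
      ∀ᶠ n : ℕ in atTop ⊓ 𝓟 {n | walkLaw z n x ≠ 0},
        θ * ((walkLaw z (n - 1) (x - a)).toReal / (walkLaw z n x).toReal - 1) ≤ 3 * θ ^ 2 := by
    intro θ hθ hθ1
    have hθ2 : 0 < θ ^ 2 := by positivity
    obtain ⟨C, hC, hCle⟩ := exists_mul_exp_le_walkLaw hz hpos hdiv
      (ε := α * θ ^ 2) (by positivity) x
    have hlim : ∀ᶠ n : ℕ in atTop, -Real.log C ≤ (α * θ ^ 2) * n :=
      (tendsto_natCast_atTop_atTop.const_mul_atTop (by positivity)).eventually_ge_atTop _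
    rw [eventually_inf_principal]
    filter_upwards [hlim, eventually_ge_atTop 1] with N hN hN1 hNx
    obtain ⟨n, rfl⟩ : ∃ n, N = n + 1 := ⟨N - 1, by lia⟩
    rw [Nat.add_sub_cancel]
    have h1 := walkLaw_mul_exp_le hz a x n θ hNx
    have h2 := hCle _ hNx
    rw [← hαdef] at h1
    set R := (walkLaw z n (x - a)).toReal / (walkLaw z (n + 1) x).toReal
    have h3 : Real.exp (Real.log C + (-(α * θ ^ 2 * (n + 1 : ℕ))) + θ * ((n + 1 : ℕ) * α * R)) ≤
        Real.exp ((n + 1 : ℕ) * (α * (Real.exp θ - 1))) := by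
      refine le_trans ?_ h1
      rw [Real.exp_add, Real.exp_add, Real.exp_log hC]
      gcongr
    rw [Real.exp_le_exp] at h3
    have h4 := (abs_le.1 (Real.abs_exp_sub_one_sub_id_le hθ1)).2
    have hNpos : (0 : ℝ) < (n + 1 : ℕ) * α := by positivity
    have h5 : ((n + 1 : ℕ) * α) * (Real.exp θ - 1) ≤ ((n + 1 : ℕ) * α) * (θ + θ ^ 2) := by
      gcongr
      linarith
    refine le_of_mul_le_mul_left ?_ hNpos
    nlinarith
  rw [Metric.tendsto_nhds]
  intro δ hδ
  set θ := min (δ / 4) 1 with hθ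
  have hθ0 : 0 < θ := by positivity
  have hθδ : 3 * θ < δ := by
    have : θ ≤ δ / 4 := min_le_left _ _
    linarith
  have hθ1 : |θ| ≤ 1 := by rw [abs_of_pos hθ0]; exact min_le_right _ _
  filter_upwards [main θ hθ0.ne' hθ1, main (-θ) (by simpa using hθ0.ne') (by rwa [abs_neg])]
    with n h1 h2
  rw [Real.dist_eq, abs_lt]
  constructor <;> nlinarith

end Ratio

/-! ### Ratio limits for the marked walk of a critical offspring distribution -/

section MarkedRatio

lemma tendsto_ratio_trans {W : ℕ → ℤ → ℝ≥0∞} {x y v : ℤ} {c d : ℕ}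
    (h : Tendsto (fun n => (W (n - c) y).toReal / (W n x).toReal)
      (atTop ⊓ 𝓟 {n | W n x ≠ 0}) (𝓝 1))
    (h' : Tendsto (fun n => (W (n - d) v).toReal / (W n y).toReal)
      (atTop ⊓ 𝓟 {n | W n y ≠ 0}) (𝓝 1)) :
    Tendsto (fun n => (W (n - (c + d)) v).toReal / (W n x).toReal)
      (atTop ⊓ 𝓟 {n | W n x ≠ 0}) (𝓝 1) := by
  have hne : ∀ᶠ n in atTop ⊓ 𝓟 {n | W n x ≠ 0}, (W (n - c) y).toReal ≠ 0 := by
    filter_upwards [h.eventually_ne one_ne_zero] with n hn h0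
    simp [h0] at hn
  have hsub : Tendsto (fun n => n - c) (atTop ⊓ 𝓟 {n | W n x ≠ 0})
      (atTop ⊓ 𝓟 {n | W n y ≠ 0}) := by
    refine tendsto_inf.2 ⟨(tendsto_sub_atTop_nat c).mono_left inf_le_left, ?_⟩
    rw [tendsto_principal]
    filter_upwards [hne] with n hn h0
    simp [h0] at hn
  have := h.mul (h'.comp hsub)
  rw [one_mul] at this
  refine this.congr' ?_
  filter_upwards [hne] with n hn
  simp only [Function.comp_apply, Nat.sub_sub]
  field_simp

variable {p : PMF ℕ} {A : Set ℕ}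

lemma exists_mem_ne_zero (hA : 0 < ∑' k : A, p (k : ℕ)) : ∃ a ∈ A, p a ≠ 0 := by
  by_contra! h
  simp [ENNReal.tsum_eq_zero.2 fun k : A => h k k.2] at hA

lemma tsum_markedLaw (hA : 0 < ∑' k : A, p (k : ℕ)) : ∑' y, markedLaw p A y = 1 := by
  have h := tsum_markedLaw_mul p A (fun _ => 1)
  have hpow : ∀ l, walkExp (Aᶜ.indicator p) walkStep l (fun _ => 1) =
      (∑' k, Aᶜ.indicator p k) ^ l := by
    intro l
    rw [walkExp_mul _ _ rfl (fun _ _ => (one_mul 1).symm)]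
    simp
  have hsum : ∑' k, A.indicator p k + ∑' k, Aᶜ.indicator p k = 1 := by
    rw [← ENNReal.tsum_add, ← p.tsum_coe]
    exact tsum_congr fun k => congrFun (Set.indicator_self_add_compl A p) k
  rw [tsum_subtype] at hA
  simp only [mul_one, hpow, ENNReal.tsum_geometric, ENNReal.tsum_mul_right] at h
  rw [h]
  set a := ∑' k, A.indicator p k
  set b := ∑' k, Aᶜ.indicator p k
  have hb : b ≠ ∞ := (lt_of_le_of_lt (hsum ▸ le_add_self) ENNReal.one_lt_top).ne
  have ha : a ≠ ∞ := (lt_of_le_of_lt (hsum ▸ le_self_add) ENNReal.one_lt_top).ne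
  nth_rw 1 [← hsum]
  rw [ENNReal.add_sub_cancel_right hb, ENNReal.mul_inv_cancel hA.ne' ha]

lemma exists_one_le_walkLaw_markedLaw_ne_zero (hp1 : p 1 < 1) (hcrit : mean p = 1)
    (hA : 0 < ∑' k : A, p (k : ℕ)) :
    ∃ r b, 1 ≤ b ∧ walkLaw (markedLaw p A) r b ≠ 0 := by
  obtain ⟨k, hk, hpk⟩ := exists_two_le_of_mean_eq_one hp1 hcrit
  obtain ⟨a, ha, hpa⟩ := exists_mem_ne_zero hA
  by_cases hkA : k ∈ A
  · refine ⟨1, walkStep k, by rw [walkStep]; lia, ?_⟩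
    rw [walkLaw_one]
    exact ((pos_iff_ne_zero.2 hpk).trans_le (le_markedLaw_walkStep (w := p) hkA)).ne'
  · refine ⟨1, walkStep a + (2 : ℕ) * walkStep k, by rw [walkStep, walkStep]; lia, ?_⟩
    rw [walkLaw_one]
    exact ((ENNReal.mul_pos hpa (pow_ne_zero 2 hpk)).trans_le (le_markedLaw (w := p) ha hkA 2)).ne'

lemma tsum_forestExp_indicator (k : ℕ) :
    ∑' n, forestExp p A k (Set.indicator {n} 1) = forestExp p A k (fun _ => 1) := by
  rw [forestExp_eq_tsum p A k (fun _ => 1)]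
  simp

lemma tsum_walkLaw_markedLaw_mul_pow (hp1 : p 1 < 1) (hcrit : mean p = 1)
    (hA : 0 < ∑' k : A, p (k : ℕ)) {y : ℝ≥0∞} (hy : 1 < y) :
    ∑' n : ℕ, walkLaw (markedLaw p A) (n + 1) (-1) * y ^ (n + 1) = ∞ := by
  have h := forestExp_pow_eq_top A hp1 hcrit hA hy
  rw [forestExp_eq_tsum] at h
  have h0 : forestExp p A 1 (Set.indicator {0} 1) ≤ 1 := by
    rw [← forestExp_one_eq_one A hp1 hcrit, ← tsum_forestExp_indicator]
    exact ENNReal.le_tsum 0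
  have h1 := ENNReal.tsum_add_one_eq_top h (by
    rw [pow_zero, one_mul]
    exact (h0.trans_lt ENNReal.one_lt_top).ne)
  rw [← top_le_iff, ← h1]
  refine ENNReal.tsum_le_tsum fun n => ?_
  have h2 := mul_forestExp p A 1 n
  rw [Nat.cast_one, one_mul, Nat.cast_one] at h2
  rw [← h2, mul_comm]
  gcongr
  exact le_mul_of_one_le_left' (by exact_mod_cast Nat.le_add_left 1 n)

variable (hp1 : p 1 < 1) (hcrit : mean p = 1) (hA : 0 < ∑' k : A, p (k : ℕ))
include hp1 hcrit hA

/-- The effect on the ratio limits of exploring one node of out-degree `j`. -/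
lemma tendsto_markedLaw_ratio {j : ℕ} (hj : p j ≠ 0) (y : ℤ) :
    Tendsto (fun n : ℕ => (walkLaw (markedLaw p A) (n - mark A j) (y - walkStep j)).toReal /
        (walkLaw (markedLaw p A) n y).toReal)
      (atTop ⊓ 𝓟 {n | walkLaw (markedLaw p A) n y ≠ 0}) (𝓝 1) := by
  have hz := tsum_markedLaw hA
  have key := fun {a : ℤ} => tendsto_walkLaw_ratio hz
    (exists_one_le_walkLaw_markedLaw_ne_zero hp1 hcrit hA)
    (fun y hy => tsum_walkLaw_markedLaw_mul_pow hp1 hcrit hA hy) (a := a)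
  by_cases hjA : j ∈ A
  · have hm : mark A j = 1 := by simp [mark, hjA]
    rw [hm]
    exact key ((pos_iff_ne_zero.2 hj).trans_le (le_markedLaw_walkStep (w := p) hjA)).ne' y
  have hm : mark A j = 0 := by simp [mark, hjA]
  obtain ⟨a, ha, hpa⟩ := exists_mem_ne_zero hA
  have hza : markedLaw p A (walkStep a) ≠ 0 :=
    ((pos_iff_ne_zero.2 hpa).trans_le (le_markedLaw_walkStep (w := p) ha)).ne'
  have hzj : markedLaw p A (walkStep a + walkStep j) ≠ 0 := by
    have := le_markedLaw (w := p) ha hjA 1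
    rw [pow_one, Nat.cast_one, one_mul] at this
    exact ((ENNReal.mul_pos hpa hj).trans_le this).ne'
  have hup : Tendsto (fun n => n + 1)
      (atTop ⊓ 𝓟 {n | walkLaw (markedLaw p A) n y ≠ 0})
      (atTop ⊓ 𝓟 {n | walkLaw (markedLaw p A) n (y + walkStep a) ≠ 0}) := by
    refine tendsto_inf.2 ⟨(tendsto_add_atTop_nat 1).mono_left inf_le_left, ?_⟩
    rw [tendsto_principal]
    refine Filter.mem_inf_of_right fun n hn => ?_
    have := walkLaw_mul_le (z := markedLaw p A) n 1 y (walkStep a)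
    rw [walkLaw_one] at this
    exact ((ENNReal.mul_pos hn hza).trans_le this).ne'
  have h1 := (key hza (y + walkStep a)).comp hup
  have h2 := (key hzj (y + walkStep a)).comp hup
  have h3 := h2.div h1 one_ne_zero
  rw [div_one] at h3
  refine h3.congr' ?_
  refine (Filter.eventually_inf_principal.2 (Eventually.of_forall fun n hn => ?_))
  have hn' : (walkLaw (markedLaw p A) (n + 1) (y + walkStep a)).toReal ≠ 0 := by
    have := walkLaw_mul_le (z := markedLaw p A) n 1 y (walkStep a)
    rw [walkLaw_one] at this
    exact (ENNReal.toReal_pos ((ENNReal.mul_pos hn hza).trans_le this).ne'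
      (walkLaw_ne_top hz _ _)).ne'
  simp only [Pi.div_apply, Function.comp_apply, Nat.add_sub_cancel, hm, Nat.sub_zero,
    add_sub_cancel_right]
  rw [div_div_div_cancel_right₀ hn', show y + walkStep a - (walkStep a + walkStep j) =
    y - walkStep j by ring]

/-- The effect on the ratio limits of exploring a finite family of nodes. -/
lemma tendsto_markedLaw_ratio_sum {ι : Type*} (s : Finset ι) (g : ι → ℕ)
    (hg : ∀ i ∈ s, p (g i) ≠ 0) (y : ℤ) :
    Tendsto (fun n : ℕ => (walkLaw (markedLaw p A) (n - ∑ i ∈ s, mark A (g i))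
        (y - ∑ i ∈ s, walkStep (g i))).toReal / (walkLaw (markedLaw p A) n y).toReal)
      (atTop ⊓ 𝓟 {n | walkLaw (markedLaw p A) n y ≠ 0}) (𝓝 1) := by
  classical
  induction s using Finset.induction_on with
  | empty =>
    refine tendsto_const_nhds.congr' (Filter.eventually_inf_principal.2
      (Eventually.of_forall fun n hn => ?_))
    have : (walkLaw (markedLaw p A) n y).toReal ≠ 0 :=
      (ENNReal.toReal_pos hn (walkLaw_ne_top (tsum_markedLaw hA) _ _)).ne'
    simp [this]
  | insert i s hi ih =>
    have h := tendsto_ratio_trans (ih fun k hk => hg k (Finset.mem_insert_of_mem hk))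
      (tendsto_markedLaw_ratio hp1 hcrit hA (hg i (Finset.mem_insert_self i s))
        (y - ∑ i ∈ s, walkStep (g i)))
    simpa only [Finset.sum_insert hi, add_comm (mark A (g i)), add_comm (walkStep (g i)),
      sub_sub] using h

end MarkedRatio

/-! ### Generations of trees -/

section Trees

/-- The nodes of `t` at height `h`. -/
def level (h : ℕ) (t : Set Node) : Set Node := {u ∈ t | u.length = h}

/-- The nodes of `t` at height less than `h`. -/
def inner (h : ℕ) (t : Set Node) : Set Node := {u ∈ t | u.length < h}

/-- The number of nodes of `t` at height less than `h` with out-degree in `A`. -/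
noncomputable def innerCount (A : Set ℕ) (h : ℕ) (t : Set Node) : ℕ :=
  ∑ᶠ u ∈ inner h t, mark A (deg t u)

lemma Y_eq_ncard_level (h : ℕ) (t : Set Node) : Y h t = (level h t).ncard := rfl

lemma cylProb_eq (p : PMF ℕ) (h : ℕ) (t : Set Node) :
    cylProb p h t = ∏ᶠ u ∈ inner h t, p (deg t u) := rfl

lemma level_restrict (h : ℕ) (t : Set Node) : level h (restrict h t) = level h t := by
  ext u
  simp only [level, restrict, Set.mem_ofPred_eq]
  grind

lemma inner_restrict (h : ℕ) (t : Set Node) : inner h (restrict h t) = inner h t := by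
  ext u
  simp only [inner, restrict, Set.mem_ofPred_eq]
  grind

lemma deg_restrict {h : ℕ} {u : Node} (hu : u.length < h) (t : Set Node) :
    deg (restrict h t) u = deg t u := by
  rw [deg, deg]
  congr 1
  ext i
  simp [restrict, Nat.succ_le_of_lt hu]

lemma Y_restrict (h : ℕ) (t : Set Node) : Y h (restrict h t) = Y h t := by
  rw [Y_eq_ncard_level, level_restrict, Y_eq_ncard_level]

lemma cylProb_restrict (p : PMF ℕ) (h : ℕ) (t : Set Node) :
    cylProb p h (restrict h t) = cylProb p h t := by
  rw [cylProb_eq, inner_restrict, cylProb_eq]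
  exact finprod_mem_congr rfl fun u hu => by rw [deg_restrict hu.2]

lemma innerCount_restrict (A : Set ℕ) (h : ℕ) (t : Set Node) :
    innerCount A h (restrict h t) = innerCount A h t := by
  rw [innerCount, inner_restrict, innerCount]
  exact finsum_mem_congr rfl fun u hu => by rw [deg_restrict hu.2]

lemma restrict_restrict_succ (h : ℕ) (t : Set Node) :
    restrict h (restrict (h + 1) t) = restrict h t := by
  ext u
  simp only [restrict, Set.mem_ofPred_eq]
  grind

lemma restrict_eq_self {h : ℕ} {t : Set Node} (ht : ∀ u ∈ t, u.length ≤ h) :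
    restrict h t = t :=
  Set.sep_eq_self_iff_mem_true.2 ht

lemma height_le_iff {h : ℕ} {t : Set Node} :
    height t ≤ (h : ℕ∞) ↔ ∀ u ∈ t, u.length ≤ h := by
  simp [height]

lemma inner_zero (t : Set Node) : inner 0 t = ∅ := by simp [inner]

@[simp] lemma cylProb_zero (p : PMF ℕ) (t : Set Node) : cylProb p 0 t = 1 := by
  simp [cylProb_eq, inner_zero]

@[simp] lemma innerCount_zero (A : Set ℕ) (t : Set Node) : innerCount A 0 t = 0 := by
  simp [innerCount, inner_zero]

lemma inner_succ (h : ℕ) (t : Set Node) : inner (h + 1) t = inner h t ∪ level h t := by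
  ext u
  simp only [inner, level, Set.mem_ofPred_eq, Set.mem_union]
  grind

lemma disjoint_inner_level (h : ℕ) (t : Set Node) : Disjoint (inner h t) (level h t) := by
  rw [Set.disjoint_left]
  intro u hu hu'
  exact hu.2.ne hu'.2

variable {t : Set Node} (ht : IsTree t)
include ht

lemma IsTree.restrict_zero : restrict 0 t = {[]} := by
  ext u
  simp only [restrict, Set.mem_ofPred_eq, Nat.le_zero, List.length_eq_zero_iff,
    Set.mem_singleton_iff]
  constructor
  · exact fun h => h.2
  · rintro rfl
    exact ⟨ht.1, rfl⟩

lemma IsTree.level_zero : level 0 t = {[]} := by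
  rw [← ht.restrict_zero]
  ext u
  simp [level, restrict]

lemma IsTree.Y_zero : Y 0 t = 1 := by
  rw [Y_eq_ncard_level, ht.level_zero, Set.ncard_singleton]

lemma IsTree.append_mem_iff {u : Node} (hu : u ∈ t) (i : ℕ+) :
    u ++ [i] ∈ t ↔ (i : ℕ) ≤ deg t u := by
  obtain ⟨k, hk⟩ := ht.2.2 u hu
  suffices deg t u = k by rw [this, hk]
  have himage : ((↑) : ℕ+ → ℕ) '' {i : ℕ+ | u ++ [i] ∈ t} = Set.Icc 1 k := by
    ext n
    simp only [hk, Set.mem_image, Set.mem_ofPred_eq, Set.mem_Icc]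
    constructor
    · rintro ⟨i, hi, rfl⟩
      exact ⟨i.2, hi⟩
    · rintro ⟨h1, h2⟩
      exact ⟨⟨n, h1⟩, h2, rfl⟩
  rw [deg, ← Set.ncard_image_of_injective _ PNat.coe_injective, himage,
    ← Finset.coe_Icc, Set.ncard_coe_finset, Nat.card_Icc, Nat.add_sub_cancel]

lemma IsTree.finite_children {u : Node} (hu : u ∈ t) : {i : ℕ+ | u ++ [i] ∈ t}.Finite := by
  simp only [ht.append_mem_iff hu]
  exact Set.Finite.of_finite_image ((Set.finite_Iic (deg t u)).subset (by
    rintro _ ⟨i, hi, rfl⟩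
    exact hi)) PNat.coe_injective.injOn

lemma IsTree.mem_of_append_mem {u : Node} {i : ℕ+} (hu : u ++ [i] ∈ t) : u ∈ t :=
  ht.2.1 _ hu _ (List.prefix_append _ _)

/-- The nodes of a tree at height `h + 1` are the children of those at height `h`. -/
noncomputable def levelSuccEquiv (h : ℕ) :
    (Σ u : level h t, {i : ℕ+ | u.1 ++ [i] ∈ t}) ≃ level (h + 1) t :=
  Equiv.ofBijective (fun x => ⟨x.1.1 ++ [x.2.1], x.2.2, by simp [x.1.2.2]⟩) <| by
    constructor
    · rintro ⟨⟨u, hu⟩, i, hi⟩ ⟨⟨v, hv⟩, j, hj⟩ huv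
      obtain ⟨rfl, hij⟩ := List.append_inj' (congrArg Subtype.val huv) rfl
      obtain rfl : i = j := by simpa using hij
      rfl
    · rintro ⟨v, hv, hlen⟩
      rcases List.eq_nil_or_concat v with rfl | ⟨u, i, rfl⟩
      · simp at hlen
      · rw [List.concat_eq_append] at hv hlen
        refine ⟨⟨⟨u, ht.mem_of_append_mem hv, by simpa using hlen⟩, i, hv⟩, ?_⟩
        simp

lemma IsTree.finite_level (h : ℕ) : (level h t).Finite := by
  induction h with
  | zero => rw [ht.level_zero]; exact Set.finite_singleton _
  | succ h ih =>
    have := ih.to_subtype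
    have (u : level h t) : Finite {i : ℕ+ | u.1 ++ [i] ∈ t} :=
      (ht.finite_children u.2.1).to_subtype
    exact Set.finite_coe_iff.1 (Finite.of_equiv _ (levelSuccEquiv ht h))

lemma IsTree.finite_inner (h : ℕ) : (inner h t).Finite := by
  induction h with
  | zero => simp [inner_zero]
  | succ h ih => rw [inner_succ]; exact ih.union (ht.finite_level h)

lemma IsTree.Y_succ (h : ℕ) : Y (h + 1) t = ∑ᶠ u ∈ level h t, deg t u := by
  have := (ht.finite_level h).fintype
  have (u : level h t) : Finite {i : ℕ+ | u.1 ++ [i] ∈ t} :=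
    (ht.finite_children u.2.1).to_subtype
  rw [Y_eq_ncard_level, ← Nat.card_coe_set_eq, ← Nat.card_congr (levelSuccEquiv ht h),
    Nat.card_sigma, ← finsum_set_coe_eq_finsum_mem, finsum_eq_sum_of_fintype]
  rfl

lemma IsTree.cylProb_succ (p : PMF ℕ) (h : ℕ) :
    cylProb p (h + 1) t = cylProb p h t * ∏ᶠ u ∈ level h t, p (deg t u) := by
  rw [cylProb_eq, inner_succ, finprod_mem_union (disjoint_inner_level h t) (ht.finite_inner h)
    (ht.finite_level h), cylProb_eq]

lemma IsTree.innerCount_succ (A : Set ℕ) (h : ℕ) :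
    innerCount A (h + 1) t = innerCount A h t + ∑ᶠ u ∈ level h t, mark A (deg t u) := by
  rw [innerCount, inner_succ, finsum_mem_union (disjoint_inner_level h t) (ht.finite_inner h)
    (ht.finite_level h), innerCount]

lemma IsTree.finite_restrict (h : ℕ) : (restrict h t).Finite :=
  (ht.finite_inner (h + 1)).subset fun _ hu => ⟨hu.1, Nat.lt_succ_of_le hu.2⟩

lemma IsTree.level_eq_empty {h : ℕ} (hY : Y h t = 0) : level h t = ∅ :=
  (Set.ncard_eq_zero (ht.finite_level h)).1 hY

lemma IsTree.inner_eq_self {h : ℕ} (hY : Y h t = 0) : inner h t = t := by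
  refine Set.sep_eq_self_iff_mem_true.2 fun u hu => ?_
  by_contra! hlen
  have : u.take h ∈ level h t := ⟨ht.2.1 u hu _ (List.take_prefix _ _), by simpa using hlen⟩
  simp [ht.level_eq_empty hY] at this

lemma IsTree.LA_eq_innerCount (A : Set ℕ) {h : ℕ} (hY : Y h t = 0) :
    LA A t = innerCount A h t := by
  classical
  have hfin := ht.finite_inner h
  rw [innerCount, finsum_mem_eq_finite_toFinset_sum _ hfin]
  rw [ht.inner_eq_self hY] at hfin
  simp only [ht.inner_eq_self hY]
  have : {u ∈ t | deg t u ∈ A} = (hfin.toFinset.filter fun u => deg t u ∈ A : Finset Node) := by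
    ext u
    simp
  rw [LA, this, Set.ncard_coe_finset, Finset.card_filter]
  refine Finset.sum_congr rfl fun u _ => ?_
  simp [mark, Set.indicator_apply]

lemma IsTree.restrict_succ_eq {s : Set Node} (hs : IsTree s) {h : ℕ}
    (hst : restrict h s = restrict h t) (hdeg : ∀ u ∈ level h t, deg s u = deg t u) :
    restrict (h + 1) s = restrict (h + 1) t := by
  have hmem : ∀ u : Node, u.length ≤ h → (u ∈ s ↔ u ∈ t) := fun u hu => by
    simpa [restrict, hu] using Set.ext_iff.1 hst u
  ext u
  simp only [restrict, Set.mem_ofPred_eq, and_congr_left_iff]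
  intro hlen
  rcases List.eq_nil_or_concat u with rfl | ⟨v, i, rfl⟩
  · exact hmem _ (Nat.zero_le h)
  rw [List.concat_eq_append] at hlen ⊢
  rw [List.length_append, List.length_singleton, Nat.add_le_add_iff_right] at hlen
  rcases hlen.lt_or_eq with hlt | heq
  · exact hmem _ (by simpa using hlt)
  by_cases hv : v ∈ t
  · rw [ht.append_mem_iff hv, hs.append_mem_iff ((hmem v hlen).2 hv), hdeg v ⟨hv, heq⟩]
  · exact iff_of_false (fun h' => hv ((hmem v hlen).1 (hs.mem_of_append_mem h')))
      fun h' => hv (ht.mem_of_append_mem h')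

/-- Every choice of out-degrees for the nodes at height `h` extends a tree of height at most
`h` to a tree of height at most `h + 1`. -/
lemma IsTree.exists_extension {h : ℕ} (hh : ∀ u ∈ t, u.length ≤ h) (g : level h t → ℕ) :
    ∃ s, IsTree s ∧ (∀ u ∈ s, u.length ≤ h + 1) ∧ restrict h s = t ∧
      ∀ u : level h t, deg s u = g u := by
  set s : Set Node := t ∪ {v | ∃ u : level h t, ∃ i : ℕ+, v = u.1 ++ [i] ∧ (i : ℕ) ≤ g u}
  have hlow : ∀ u : Node, u.length ≤ h → (u ∈ s ↔ u ∈ t) := by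
    intro u hu
    refine ⟨?_, Or.inl⟩
    rintro (hu' | ⟨v, i, rfl, -⟩)
    · exact hu'
    · rw [List.length_append, v.2.2] at hu
      simp at hu
  have hhigh : ∀ (u : level h t) (i : ℕ+), u.1 ++ [i] ∈ s ↔ (i : ℕ) ≤ g u := by
    intro u i
    constructor
    · rintro (hu' | ⟨v, j, hv, hj⟩)
      · have := hh _ hu'
        rw [List.length_append, u.2.2] at this
        simp at this
      · obtain ⟨huv, hij⟩ := List.append_inj' hv rfl
        obtain rfl : i = j := by simpa using hij
        rwa [Subtype.ext huv]
    · exact fun hi => Or.inr ⟨u, i, rfl, hi⟩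
  have hlen : ∀ u ∈ s, u.length ≤ h + 1 := by
    rintro u (hu | ⟨v, i, rfl, -⟩)
    · exact (hh u hu).trans (Nat.le_succ h)
    · simp [v.2.2]
  have hs : IsTree s := by
    refine ⟨Or.inl ht.1, ?_, ?_⟩
    · rintro u (hu | ⟨v, i, rfl, hi⟩) w hw
      · exact Or.inl (ht.2.1 u hu w hw)
      · rcases List.prefix_concat_iff.1 hw with rfl | hw
        · exact Or.inr ⟨v, i, rfl, hi⟩
        · exact Or.inl (ht.2.1 v v.2.1 w hw)
    · intro u hu
      rcases lt_trichotomy u.length h with hlt | heq | hgt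
      · obtain ⟨k, hk⟩ := ht.2.2 u ((hlow u hlt.le).1 hu)
        exact ⟨k, fun i => (hlow _ (by simpa using hlt)).trans (hk i)⟩
      · exact ⟨g ⟨u, (hlow u heq.le).1 hu, heq⟩, hhigh ⟨u, (hlow u heq.le).1 hu, heq⟩⟩
      · refine ⟨0, fun i => iff_of_false (fun hi => ?_) (by simp)⟩
        have := hlen _ hi
        rw [List.length_append, List.length_singleton] at this
        lia
  refine ⟨s, hs, hlen, ?_, fun u => ?_⟩
  · ext u
    simp only [restrict, Set.mem_ofPred_eq]
    exact ⟨fun hu => (hlow u hu.2).1 hu.1, fun hu => ⟨Or.inl hu, hh u hu⟩⟩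
  · have hu := hs.append_mem_iff (Or.inl u.2.1 : u.1 ∈ s)
    refine eq_of_forall_le_iff fun n => ?_
    rcases n with _ | n
    · simp
    · exact (hu ⟨n + 1, n.succ_pos⟩).symm.trans (hhigh u ⟨n + 1, n.succ_pos⟩)

end Trees

/-! ### The law of a Galton–Watson tree conditioned on its first generations -/

section GaltonWatson

variable {Ω : Type*} [MeasurableSpace Ω] {P : Measure Ω} {p : PMF ℕ} {τ : Ω → Set Node}

lemma IsGW.measurableSet_restrict (hGW : IsGW P p τ) (h : ℕ) (s : Set Node) :
    MeasurableSet {ω | restrict h (τ ω) = s} :=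
  hGW.2.1 (MeasurableSpace.measurableSet_generateFrom ⟨h, s, rfl⟩)

lemma IsGW.measurableSet_Y_eq_zero (hGW : IsGW P p τ) (h : ℕ) :
    MeasurableSet {ω | Y h (τ ω) = 0} := by
  have : {ω | Y h (τ ω) = 0} =
      ⋃ s : {s : Finset Node // Y h (s : Set Node) = 0}, {ω | restrict h (τ ω) = s.1} := by
    ext ω
    simp only [Set.mem_ofPred_eq, Set.mem_iUnion, Subtype.exists, exists_prop]
    constructor
    · intro hω
      refine ⟨((hGW.1 ω).finite_restrict h).toFinset, ?_, ?_⟩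
      · rw [Set.Finite.coe_toFinset, Y_restrict, hω]
      · rw [Set.Finite.coe_toFinset]
    · rintro ⟨s, hs, hω⟩
      rw [← Y_restrict, hω, hs]
  rw [this]
  exact MeasurableSet.iUnion fun s => hGW.measurableSet_restrict h _

variable [IsProbabilityMeasure P]

lemma IsGW.measure_restrict (hGW : IsGW P p τ) (h : ℕ) {t : Set Node} (ht : IsTree t)
    (hh : ∀ u ∈ t, u.length ≤ h) : P {ω | restrict h (τ ω) = t} = cylProb p h t := by
  rcases Nat.eq_zero_or_pos h with rfl | hpos
  · have : t = {[]} := by rw [← ht.restrict_zero, restrict_eq_self hh]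
    simp [this, (hGW.1 _).restrict_zero]
  · exact hGW.2.2 h hpos t ht (height_le_iff.2 hh)

lemma IsGW.measure_restrict_inter_eq_bfsExp (hGW : IsGW P p τ) (A N : Set ℕ) (d h : ℕ)
    {t : Set Node} (ht : IsTree t) (hh : ∀ u ∈ t, u.length ≤ h) :
    P ({ω | restrict h (τ ω) = t} ∩
        {ω | Y (h + d) (τ ω) = 0 ∧ innerCount A (h + d) (τ ω) ∈ N}) =
      cylProb p h t *
        bfsExp p A d (Y h t) (fun c => N.indicator 1 (innerCount A h t + c)) := by
  induction d generalizing h t with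
  | zero =>
    have heq : {ω | restrict h (τ ω) = t} ∩
        {ω | Y (h + 0) (τ ω) = 0 ∧ innerCount A (h + 0) (τ ω) ∈ N} =
        {ω | restrict h (τ ω) = t ∧ Y h t = 0 ∧ innerCount A h t ∈ N} := by
      ext ω
      simp only [Set.mem_inter_iff, Set.mem_ofPred_eq, add_zero, and_congr_right_iff]
      rintro rfl
      rw [Y_restrict, innerCount_restrict]
    rw [heq, bfsExp_zero]
    by_cases hY : Y h t = 0
    · by_cases hN : innerCount A h t ∈ N
      · simp [hY, hN, hGW.measure_restrict h ht hh]
      · simp [hN]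
    · simp [hY]
  | succ d ih =>
    have hfin := (ht.finite_level h).fintype
    choose s hs hlen hres hdeg using ht.exists_extension hh
    have hlevel : ∀ g, level h (s g) = level h t := fun g => by
      rw [← level_restrict, hres]
    set E := {ω | Y (h + (d + 1)) (τ ω) = 0 ∧ innerCount A (h + (d + 1)) (τ ω) ∈ N} with hE
    have hunion : {ω | restrict h (τ ω) = t} =
        ⋃ g, {ω | restrict (h + 1) (τ ω) = s g} := by
      ext ω
      simp only [Set.mem_ofPred_eq, Set.mem_iUnion]
      constructor
      · intro hω
        set g : level h t → ℕ := fun u => deg (τ ω) u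
        refine ⟨g, ?_⟩
        rw [← restrict_eq_self (hlen _)]
        refine (hs _).restrict_succ_eq (hGW.1 ω) (hω.trans (hres _).symm) fun u hu => ?_
        rw [hlevel] at hu
        exact (hdeg g ⟨u, hu⟩).symm
      · rintro ⟨g, hω⟩
        rw [← restrict_restrict_succ, hω, hres]
    have hdisj : Pairwise (Function.onFun Disjoint
        fun g => {ω | restrict (h + 1) (τ ω) = s g}) := by
      intro g g' hgg
      rw [Function.onFun, Set.disjoint_left]
      intro ω hω hω'
      refine hgg (funext fun u => ?_)
      rw [← hdeg g, ← hdeg g', ← show _ = s g from hω, ← show _ = s g' from hω']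
    have hterm : ∀ g, P ({ω | restrict (h + 1) (τ ω) = s g} ∩ E) = cylProb p h t *
        ((∏ u, p (g u)) * bfsExp p A d (∑ u, degStep A (g u)).1 (fun c =>
          N.indicator 1 (innerCount A h t + ((∑ u, degStep A (g u)).2 + c)))) := by
      intro g
      have hprod : ∏ᶠ u ∈ level h (s g), p (deg (s g) u) = ∏ u, p (g u) := by
        rw [hlevel, ← finprod_set_coe_eq_finprod_mem, finprod_eq_prod_of_fintype]
        exact Finset.prod_congr rfl fun u _ => by rw [hdeg]
      have hsum : ∀ f : ℕ → ℕ, ∑ᶠ u ∈ level h (s g), f (deg (s g) u) = ∑ u, f (g u) := by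
        intro f
        rw [hlevel, ← finsum_set_coe_eq_finsum_mem, finsum_eq_sum_of_fintype]
        exact Finset.sum_congr rfl fun u _ => by rw [hdeg]
      rw [hE, show h + (d + 1) = h + 1 + d by ring, ih (h + 1) (hs g) (hlen g),
        (hs g).cylProb_succ, hprod, (hs g).Y_succ,
        hsum (fun k => k), (hs g).innerCount_succ, hsum (mark A), ← cylProb_restrict,
        ← innerCount_restrict, hres, mul_assoc]
      simp only [Prod.fst_sum, Prod.snd_sum, degStep, add_assoc]
    rw [← Measure.restrict_apply (hGW.measurableSet_restrict h t), hunion,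
      measure_iUnion hdisj fun g => hGW.measurableSet_restrict _ _]
    simp only [Measure.restrict_apply (hGW.measurableSet_restrict _ _), hterm]
    rw [ENNReal.tsum_mul_left, bfsExp_succ, Y_eq_ncard_level, ← Nat.card_coe_set_eq,
      Nat.card_eq_fintype_card]
    congr 1
    exact tsum_prod_eq_walkExp _ _ (fun x : ℕ × ℕ => bfsExp p A d x.1
      (fun c => N.indicator 1 (innerCount A h t + (x.2 + c))))

lemma IsGW.measure_restrict_inter_eq_forestExp (hGW : IsGW P p τ) (A N : Set ℕ) (h : ℕ)
    {t : Set Node} (ht : IsTree t) (hh : ∀ u ∈ t, u.length ≤ h) :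
    P ({ω | restrict h (τ ω) = t} ∩ {ω | (∃ d, Y d (τ ω) = 0) ∧ LA A (τ ω) ∈ N}) =
      cylProb p h t * forestExp p A (Y h t) (fun c => N.indicator 1 (innerCount A h t + c)) := by
  have hmono : ∀ ω, ∀ d, Y d (τ ω) = 0 → ∀ k, Y (d + k) (τ ω) = 0 := by
    intro ω d hd k
    induction k with
    | zero => exact hd
    | succ k ih =>
      rw [← add_assoc, (hGW.1 ω).Y_succ, (hGW.1 ω).level_eq_empty ih, finsum_mem_empty]
  have hset : {ω | restrict h (τ ω) = t} ∩ {ω | (∃ d, Y d (τ ω) = 0) ∧ LA A (τ ω) ∈ N} =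
      ⋃ d, {ω | restrict h (τ ω) = t} ∩
        {ω | Y (h + d) (τ ω) = 0 ∧ innerCount A (h + d) (τ ω) ∈ N} := by
    rw [← Set.inter_iUnion]
    congr 1
    ext ω
    simp only [Set.mem_ofPred_eq, Set.mem_iUnion]
    constructor
    · rintro ⟨⟨d, hd⟩, hN⟩
      have := hmono ω d hd h
      rw [add_comm] at this
      exact ⟨d, this, by rwa [← (hGW.1 ω).LA_eq_innerCount A this]⟩
    · rintro ⟨d, hd, hN⟩
      exact ⟨⟨_, hd⟩, by rwa [(hGW.1 ω).LA_eq_innerCount A hd]⟩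
  rw [hset, Monotone.measure_iUnion, ← iSup_bfsExp, ENNReal.mul_iSup]
  · simp only [hGW.measure_restrict_inter_eq_bfsExp A N _ h ht hh]
  · refine monotone_nat_of_le_succ fun d => ?_
    refine Set.inter_subset_inter_right _ fun ω hω => ?_
    have hd := hmono ω _ hω.1 1
    exact ⟨hd, by
      rw [← add_assoc, ← (hGW.1 ω).LA_eq_innerCount A hd,
        (hGW.1 ω).LA_eq_innerCount A hω.1]
      exact hω.2⟩

lemma isTree_singleton_nil : IsTree {([] : Node)} := by
  refine ⟨rfl, ?_, ?_⟩
  · rintro _ rfl v hv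
    exact List.prefix_nil.1 hv
  · rintro _ rfl
    exact ⟨0, fun i => by simp⟩

lemma IsGW.ae_exists_Y_eq_zero (hGW : IsGW P p τ) (hp1 : p 1 < 1) (hcrit : mean p = 1) :
    ∀ᵐ ω ∂P, ∃ d, Y d (τ ω) = 0 := by
  have h := hGW.measure_restrict_inter_eq_forestExp ∅ Set.univ 0 isTree_singleton_nil
    (by simp)
  simp only [(hGW.1 _).restrict_zero, isTree_singleton_nil.Y_zero, cylProb_zero, one_mul,
    Set.mem_univ, and_true, Set.ofPred_true, Set.univ_inter, Set.indicator_univ, Pi.one_apply,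
    forestExp_one_eq_one ∅ hp1 hcrit] at h
  have hmeas : MeasurableSet {ω | ∃ d, Y d (τ ω) = 0} := by
    simp only [Set.ofPred_exists]
    exact MeasurableSet.iUnion hGW.measurableSet_Y_eq_zero
  rw [← prob_compl_eq_zero_iff hmeas] at h
  exact h

lemma IsGW.measure_restrict_inter_LA (hGW : IsGW P p τ) (hp1 : p 1 < 1) (hcrit : mean p = 1)
    (A : Set ℕ) (n h : ℕ) {t : Set Node} (ht : IsTree t) (hh : ∀ u ∈ t, u.length ≤ h) :
    P ({ω | restrict h (τ ω) = t} ∩ {ω | LA A (τ ω) = n}) =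
      cylProb p h t *
        forestExp p A (Y h t) (fun c => Set.indicator {n} 1 (innerCount A h t + c)) := by
  rw [← hGW.measure_restrict_inter_eq_forestExp A {n} h ht hh]
  refine measure_congr (Filter.eventuallyEq_set.2 ?_)
  filter_upwards [hGW.ae_exists_Y_eq_zero hp1 hcrit] with ω hω
  simp [hω]

lemma IsGW.measure_LA (hGW : IsGW P p τ) (hp1 : p 1 < 1) (hcrit : mean p = 1)
    (A : Set ℕ) (n : ℕ) :
    P {ω | LA A (τ ω) = n} = forestExp p A 1 (Set.indicator {n} 1) := by
  have h := hGW.measure_restrict_inter_LA hp1 hcrit A n 0 isTree_singleton_nil (by simp)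
  simpa [(hGW.1 _).restrict_zero, isTree_singleton_nil.Y_zero] using h

end GaltonWatson

section Limit

variable {p : PMF ℕ} {A : Set ℕ}

/-- The effect on the ratio limits of exploring the first generations of a tree. -/
lemma IsTree.tendsto_markedLaw_ratio (hp1 : p 1 < 1) (hcrit : mean p = 1)
    (hA : 0 < ∑' k : A, p (k : ℕ)) {t : Set Node} (ht : IsTree t) (h : ℕ)
    (hc : cylProb p h t ≠ 0) :
    Tendsto (fun n : ℕ => (walkLaw (markedLaw p A) (n - innerCount A h t) (-Y h t)).toReal /
        (walkLaw (markedLaw p A) n (-1)).toReal)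
      (atTop ⊓ 𝓟 {n | walkLaw (markedLaw p A) n (-1) ≠ 0}) (𝓝 1) := by
  induction h with
  | zero =>
    have := tendsto_markedLaw_ratio_sum hp1 hcrit hA (∅ : Finset ℕ) id (by simp) (-1)
    simpa [ht.Y_zero] using this
  | succ h ih =>
    have hfin := ht.finite_level h
    rw [ht.cylProb_succ, finprod_mem_eq_finite_toFinset_prod _ hfin, mul_ne_zero_iff,
      Finset.prod_ne_zero_iff] at hc
    have key := tendsto_ratio_trans (ih hc.1)
      (tendsto_markedLaw_ratio_sum hp1 hcrit hA hfin.toFinset (deg t) hc.2 (-Y h t))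
    have hY : (-Y h t - ∑ u ∈ hfin.toFinset, walkStep (deg t u) : ℤ) = -Y (h + 1) t := by
      rw [ht.Y_succ, finsum_mem_eq_finite_toFinset_sum _ hfin, Y_eq_ncard_level,
        Set.ncard_eq_toFinset_card _ hfin]
      simp only [walkStep, Finset.sum_sub_distrib, Finset.sum_const, nsmul_eq_mul, mul_one,
        Nat.cast_sum]
      ring
    rwa [hY, ← finsum_mem_eq_finite_toFinset_sum (fun u => mark A (deg t u)) hfin,
      ← ht.innerCount_succ] at key

end Limit

/-- **Corollary (local convergence under conditioning on the number of nodes with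
out-degree in `𝒜`).** Let `τ` be a critical GW tree with offspring distribution `p` and
`𝒜 ⊂ ℤ₊` with `p(𝒜) > 0`. Then, along `{n ∈ ℕ : P[L_𝒜(τ) = n] > 0}`, `τ` conditioned on
`{L_𝒜(τ) = n}` converges locally in distribution to Kesten's immortal tree `τ*`. -/
theorem gw_LA_local_convergence
    {Ω : Type*} [MeasurableSpace Ω] (P : Measure Ω) [IsProbabilityMeasure P]
    (p : PMF ℕ) (hp1 : p 1 < 1) (hcrit : mean p = 1)
    (τ : Ω → Set Node) (hGW : IsGW P p τ)
    (𝒜 : Set ℕ) (h𝒜 : 0 < ∑' k : 𝒜, p (k : ℕ)) :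
    ∀ h : ℕ, 1 ≤ h → ∀ t : Set Node, IsTree t → height t ≤ (h : ℕ∞) →
      Tendsto
        (fun n : ℕ =>
          P ({ω | restrict h (τ ω) = t} ∩ {ω | LA 𝒜 (τ ω) = n}) /
            P {ω | LA 𝒜 (τ ω) = n})
        (atTop ⊓ 𝓟 {n : ℕ | P {ω | LA 𝒜 (τ ω) = n} ≠ 0}) (𝓝 (kesten p h t)) := by
  intro h hh t ht hht
  rw [height_le_iff] at hht
  have hnum := fun n => hGW.measure_restrict_inter_LA hp1 hcrit 𝒜 n h ht hht
  have hden := hGW.measure_LA hp1 hcrit 𝒜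
  by_cases hc : cylProb p h t = 0
  · simp only [hnum, hc, kesten, zero_mul, ENNReal.zero_div, mul_zero]
    exact tendsto_const_nhds
  have hctop : cylProb p h t ≠ ∞ := by
    rw [← hGW.measure_restrict h ht hht]
    exact measure_ne_top _ _
  set c := innerCount 𝒜 h t
  set k := Y h t with hk
  set W := walkLaw (markedLaw p 𝒜)
  set f : ℕ → ℝ≥0∞ := fun n => P {ω | LA 𝒜 (τ ω) = n} with hf
  have hfW : ∀ n : ℕ, 1 ≤ n → (n : ℝ) * (f n).toReal = (W n (-1)).toReal := by
    intro n hn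
    obtain ⟨m, rfl⟩ := Nat.exists_eq_add_of_le' hn
    have := congrArg ENNReal.toReal (mul_forestExp p 𝒜 1 m)
    rw [← hden, Nat.cast_one, one_mul, ENNReal.toReal_mul, ENNReal.toReal_natCast] at this
    exact_mod_cast this
  have hfpos : ∀ n, f n ≠ 0 → 0 < (f n).toReal := fun n hn =>
    ENNReal.toReal_pos hn (measure_ne_top _ _)
  have hle : atTop ⊓ 𝓟 {n | f n ≠ 0} ≤ atTop ⊓ 𝓟 {n | W n (-1) ≠ 0} := by
    refine le_inf inf_le_left (le_principal_iff.2 ?_)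
    rw [← Filter.eventually_mem_set, eventually_inf_principal]
    filter_upwards [eventually_ge_atTop 1] with n hn hfn hW
    have h1 := hfW n hn
    rw [hW, ENNReal.toReal_zero] at h1
    have := hfpos n hfn
    have : (0 : ℝ) < n := by exact_mod_cast hn
    exact (by positivity : (n : ℝ) * (f n).toReal ≠ 0) h1
  have hratio := (ht.tendsto_markedLaw_ratio hp1 hcrit h𝒜 h hc).mono_left hle
  have hshift : Tendsto (fun n : ℕ => (n : ℝ) / (n - c : ℝ)) atTop (𝓝 1) := by
    simpa [sub_eq_add_neg] using tendsto_natCast_div_add_atTop (-(c : ℝ))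
  have hlim := ENNReal.tendsto_ofReal
    (((hratio.mul (hshift.mono_left inf_le_left)).const_mul ((cylProb p h t).toReal * k)))
  have hkesten : ENNReal.ofReal ((cylProb p h t).toReal * k * (1 * 1)) = kesten p h t := by
    rw [kesten, hcrit, inv_one, one_pow, one_mul, one_mul, mul_one,
      ENNReal.ofReal_mul ENNReal.toReal_nonneg, ENNReal.ofReal_toReal hctop,
      ENNReal.ofReal_natCast, mul_comm]
  rw [hkesten] at hlim
  refine hlim.congr' (eventually_inf_principal.2 ?_)
  filter_upwards [eventually_ge_atTop (c + 1)] with n hn hfn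
  obtain ⟨m, rfl⟩ := Nat.exists_eq_add_of_le hn
  have hdiv : P ({ω | restrict h (τ ω) = t} ∩ {ω | LA 𝒜 (τ ω) = c + 1 + m}) /
      f (c + 1 + m) ≠ ∞ :=
    ENNReal.div_ne_top (measure_ne_top _ _) hfn
  rw [← ENNReal.ofReal_toReal hdiv]
  congr 1
  have hforest : forestExp p 𝒜 k (fun d => Set.indicator {c + 1 + m} 1 (c + d)) =
      forestExp p 𝒜 k (Set.indicator {m + 1} 1) := by
    congr 1
    ext d
    simp only [Set.indicator_apply, Set.mem_singleton_iff, Pi.one_apply,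
      show c + d = c + 1 + m ↔ d = m + 1 by lia]
  have hX := congrArg ENNReal.toReal (mul_forestExp p 𝒜 k m)
  rw [ENNReal.toReal_mul, ENNReal.toReal_mul, ENNReal.toReal_natCast,
    ENNReal.toReal_natCast] at hX
  rw [ENNReal.toReal_div, hnum, ENNReal.toReal_mul, hforest, ← hfW _ (by lia),
    show c + 1 + m - c = m + 1 by lia]
  have h1 := hfpos _ hfn
  set x := (forestExp p 𝒜 k (Set.indicator {m + 1} 1)).toReal
  have h2 : ((c + 1 + m : ℕ) : ℝ) - c = (m + 1 : ℕ) := by push_cast; ring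
  have h3 : (0 : ℝ) < (c + 1 + m : ℕ) := by positivity
  have h4 : (0 : ℝ) < (m + 1 : ℕ) := by positivity
  rw [h2]
  calc (cylProb p h t).toReal * k * ((W (m + 1) (-k)).toReal /
        ((c + 1 + m : ℕ) * (f (c + 1 + m)).toReal) * ((c + 1 + m : ℕ) / (m + 1 : ℕ)))
      = (cylProb p h t).toReal * ((k * (W (m + 1) (-k)).toReal) / (m + 1 : ℕ)) /
          (f (c + 1 + m)).toReal := by field_simp
    _ = (cylProb p h t).toReal * x / (f (c + 1 + m)).toReal := by
        rw [← hX, mul_div_cancel_left₀ _ h4.ne']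

end GWLocal
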